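/- arXiv:2409.04582 — 5 statements merged into one kernel-verified Lean document; each statement's English description precedes it below -/
import Mathlib

section
/- For every G-invariant holomorphic function F : 𝔻^d → ℂ with |F(z)| ≤ 1 for all z ∈ 𝔻^d, there exists a sequence (h_j) of G-invariant rational inner functions (rational functions holomorphic on an open neighborhood of the closed polydisc whose modulus equals 1 at every point of 𝕋^d) such that h_j → F uniformly on every compact subset of 𝔻^d. (This is the Carathéodory approximation theorem on the quotient domain θ(𝔻^d), stated equivalently after composing with θ.) -/
open MeasureTheory Filter Topology Matrix MvPolynomial

noncomputable section

/-- The open unit polydisc in `ℂ^d`. -/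
def polydisc (d : ℕ) : Set (Fin d → ℂ) := {z | ∀ i, ‖z i‖ < 1}

/-- The closed unit polydisc in `ℂ^d`. -/
def closedPolydisc (d : ℕ) : Set (Fin d → ℂ) := {z | ∀ i, ‖z i‖ ≤ 1}

/-- The distinguished boundary (torus) of the polydisc. -/
def torus (d : ℕ) : Set (Fin d → ℂ) := {z | ∀ i, ‖z i‖ = 1}

/-- A rational inner function on the polydisc: a rational function holomorphic on an open
neighbourhood of the closed polydisc whose modulus equals `1` at every point of `𝕋^d`. -/
def IsRationalInner {d : ℕ} (h : (Fin d → ℂ) → ℂ) : Prop :=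
  ∃ (p q : MvPolynomial (Fin d) ℂ) (U : Set (Fin d → ℂ)),
    IsOpen U ∧ closedPolydisc d ⊆ U ∧
    (∀ z ∈ U, eval z q ≠ 0 ∧ h z = eval z p / eval z q) ∧
    (∀ z ∈ torus d, ‖h z‖ = 1)

/-- A holomorphic function on the unit disc bounded by `1` is the sum of a power series with
coefficients bounded by `1`. -/
lemma exists_hasSum_pow_of_norm_le_one {f : ℂ → ℂ}
    (hf : DifferentiableOn ℂ f (Metric.ball 0 1)) (hf1 : ∀ z ∈ Metric.ball (0 : ℂ) 1, ‖f z‖ ≤ 1) :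
    ∃ a : ℕ → ℂ, (∀ k, ‖a k‖ ≤ 1) ∧
      ∀ z ∈ Metric.ball (0 : ℂ) 1, HasSum (fun k => a k * z ^ k) (f z) := by
  refine ⟨fun k => (k.factorial : ℂ)⁻¹ * iteratedDeriv k f 0, fun k => ?_, fun z hz => ?_⟩
  · have hbound : ∀ R ∈ Set.Ioo (0 : ℝ) 1,
        ‖(k.factorial : ℂ)⁻¹ * iteratedDeriv k f 0‖ * R ^ k ≤ 1 := by
      rintro R ⟨hR0, hR1⟩
      have hsub : Metric.closedBall (0 : ℂ) R ⊆ Metric.ball 0 1 :=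
        Metric.closedBall_subset_ball hR1
      have h := Complex.norm_iteratedDeriv_le_of_forall_mem_sphere_norm_le k hR0
        ((hf.mono hsub).diffContOnCl_ball subset_rfl)
        (fun z hz => hf1 z (hsub (Metric.sphere_subset_closedBall hz)))
      have hk : (0 : ℝ) < k.factorial := by exact_mod_cast k.factorial_pos
      rw [mul_one, le_div_iff₀ (by positivity)] at h
      rw [norm_mul, norm_inv, Complex.norm_natCast, mul_assoc, inv_mul_le_iff₀ hk, mul_one]
      exact h
    have hlim : Tendsto (fun R : ℝ => ‖(k.factorial : ℂ)⁻¹ * iteratedDeriv k f 0‖ * R ^ k)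
        (𝓝[<] 1) (𝓝 (‖(k.factorial : ℂ)⁻¹ * iteratedDeriv k f 0‖ * 1 ^ k)) :=
      ((continuous_const.mul (continuous_pow k)).tendsto 1).mono_left nhdsWithin_le_nhds
    rw [one_pow, mul_one] at hlim
    exact le_of_tendsto hlim
      (Filter.mem_of_superset (Ioo_mem_nhdsLT zero_lt_one) hbound)
  · convert! Complex.hasSum_taylorSeries_on_ball hf hz using 2 with k
    simp only [smul_eq_mul, sub_zero]
    ring

/-- Interpolation at roots of unity reproduces monomials of low degree. -/
lemma sum_pow_mul_sum_inv_pow {N : ℕ} {ω : ℂ} (hω : IsPrimitiveRoot ω N) {ρ : ℂ} (hρ : ρ ≠ 0)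
    {k : ℕ} (hk : k < N) (z : ℂ) :
    ∑ j ∈ Finset.range N, (ρ * ω ^ j) ^ k *
      ∑ m ∈ Finset.range N, ((N : ℂ)⁻¹ * ((ρ * ω ^ j) ^ m)⁻¹) * z ^ m = z ^ k := by
  have hω0 : ω ≠ 0 := hω.ne_zero (by omega)
  have hN : (N : ℂ) ≠ 0 := by exact_mod_cast (by omega : N ≠ 0)
  have orth : ∀ m < N, ∑ j ∈ Finset.range N, (ω ^ k / ω ^ m) ^ j =
      if m = k then (N : ℂ) else 0 := by
    intro m hm
    split_ifs with h
    · subst h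
      simp [div_self (pow_ne_zero m hω0)]
    · have hne : ω ^ k / ω ^ m ≠ 1 := by
        intro h1
        rw [div_eq_one_iff_eq (pow_ne_zero m hω0)] at h1
        exact h (hω.pow_inj hm hk h1.symm)
      rw [geom_sum_eq hne, div_pow, ← pow_mul, ← pow_mul, mul_comm k, mul_comm m, pow_mul, pow_mul,
        hω.pow_eq_one]
      simp
  calc _ = ∑ m ∈ Finset.range N, (N : ℂ)⁻¹ * (ρ ^ k * (ρ ^ m)⁻¹ * z ^ m) *
        ∑ j ∈ Finset.range N, (ω ^ k / ω ^ m) ^ j := by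
        simp_rw [Finset.mul_sum]
        rw [Finset.sum_comm]
        refine Finset.sum_congr rfl fun m _ => Finset.sum_congr rfl fun j _ => ?_
        rw [mul_pow, mul_pow, div_pow, mul_inv, ← pow_mul, ← pow_mul, ← pow_mul, ← pow_mul,
          mul_comm k, mul_comm m]
        ring
    _ = ∑ m ∈ Finset.range N, if m = k then z ^ k else 0 := by
        refine Finset.sum_congr rfl fun m hm => ?_
        rw [orth m (Finset.mem_range.1 hm)]
        split_ifs with h
        · subst h
          field_simp
        · simp
    _ = z ^ k := by simp [hk]

/-- Holomorphic functions on the unit disc bounded by `1` are uniformly approximated on a smaller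
disc by an interpolation operator with nodes in the disc, independent of the function. -/
lemma exists_disc_interpolation {r : ℝ} (hr0 : 0 ≤ r) (hr : r < 1) {ε : ℝ} (hε : 0 < ε) :
    ∃ (N : ℕ) (w : ℕ → ℂ) (L : ℕ → Polynomial ℂ), (∀ j, ‖w j‖ < 1) ∧
      ∀ f : ℂ → ℂ, DifferentiableOn ℂ f (Metric.ball 0 1) →
        (∀ z ∈ Metric.ball (0 : ℂ) 1, ‖f z‖ ≤ 1) → ∀ z : ℂ, ‖z‖ ≤ r →
        ‖f z - ∑ j ∈ Finset.range N, f (w j) * (L j).eval z‖ ≤ ε := by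
  obtain ⟨ρ, hrρ, hρ1⟩ := exists_between hr
  have hρ0 : 0 < ρ := hr0.trans_lt hrρ
  set q := r / ρ with hq
  have hq0 : 0 ≤ q := by positivity
  have hq1 : q < 1 := (div_lt_one hρ0).2 hrρ
  set C := (1 - q)⁻¹ with hC
  have hC0 : 0 < C := inv_pos.2 (by linarith)
  have hlim : Tendsto (fun N : ℕ => (1 + C) * ρ ^ N * (1 - ρ)⁻¹) atTop (𝓝 0) := by
    simpa using ((tendsto_pow_atTop_nhds_zero_of_lt_one hρ0.le hρ1).const_mul (1 + C)).mul_const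
      (1 - ρ)⁻¹
  obtain ⟨N, hNε, hN0⟩ := ((hlim.eventually (gt_mem_nhds hε)).and (eventually_ge_atTop 1)).exists
  obtain ⟨ω, hω⟩ : ∃ ω : ℂ, IsPrimitiveRoot ω N :=
    ⟨_, Complex.isPrimitiveRoot_exp N (by omega)⟩
  have hω1 : ‖ω‖ = 1 := hω.norm'_eq_one (by omega)
  have hw : ∀ j, ‖(ρ : ℂ) * ω ^ j‖ = ρ := fun j => by
    simp [hω1, abs_of_pos hρ0]
  refine ⟨N, fun j => ρ * ω ^ j, fun j => ∑ m ∈ Finset.range N,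
    Polynomial.C ((N : ℂ)⁻¹ * ((ρ * ω ^ j) ^ m)⁻¹) * Polynomial.X ^ m,
    fun j => (hw j).trans_lt hρ1, fun f hf hf1 z hz => ?_⟩
  simp only [Polynomial.eval_finsetSum, Polynomial.eval_mul, Polynomial.eval_C,
    Polynomial.eval_pow, Polynomial.eval_X]
  set L : ℕ → ℂ := fun j =>
    ∑ m ∈ Finset.range N, ((N : ℂ)⁻¹ * ((ρ * ω ^ j) ^ m)⁻¹) * z ^ m with hL
  have hNC : (0 : ℝ) < N := by exact_mod_cast hN0
  have hLbound : ∀ j, ‖L j‖ ≤ (N : ℝ)⁻¹ * C := by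
    intro j
    calc ‖L j‖ ≤ ∑ m ∈ Finset.range N, (N : ℝ)⁻¹ * q ^ m := by
          refine norm_sum_le_of_le _ fun m _ => ?_
          rw [norm_mul, norm_mul, norm_inv, norm_inv, norm_pow, norm_pow, hw, Complex.norm_natCast,
            mul_assoc, hq, div_pow, div_eq_inv_mul]
          gcongr
      _ ≤ (N : ℝ)⁻¹ * C := by
          rw [← Finset.mul_sum]
          gcongr
          rw [hC, ← tsum_geometric_of_lt_one hq0 hq1]
          exact (summable_geometric_of_lt_one hq0 hq1).sum_le_tsum _ fun i _ => by positivity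
  obtain ⟨a, ha1, ha⟩ := exists_hasSum_pow_of_norm_le_one hf hf1
  have hmem : ∀ u : ℂ, ‖u‖ < 1 → u ∈ Metric.ball (0 : ℂ) 1 := fun u hu => by simpa using hu
  have hsum : HasSum (fun k => a k * (z ^ k - ∑ j ∈ Finset.range N, (ρ * ω ^ j) ^ k * L j))
      (f z - ∑ j ∈ Finset.range N, f (ρ * ω ^ j) * L j) := by
    convert! (ha z (hmem z (hz.trans_lt hr))).sub (hasSum_sum fun j (_ : j ∈ Finset.range N) =>
      (ha _ (hmem _ ((hw j).trans_lt hρ1))).mul_right (L j)) using 2 with k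
    rw [mul_sub, Finset.mul_sum]
    simp only [mul_assoc]
  have hlow : ∑ k ∈ Finset.range N,
      a k * (z ^ k - ∑ j ∈ Finset.range N, (ρ * ω ^ j) ^ k * L j) = 0 := by
    refine Finset.sum_eq_zero fun k hk => ?_
    rw [hL, sum_pow_mul_sum_inv_pow hω (by exact_mod_cast hρ0.ne') (Finset.mem_range.1 hk),
      sub_self, mul_zero]
  rw [← hasSum_nat_add_iff' N, hlow, sub_zero] at hsum
  refine (hsum.norm_le_of_bounded (((hasSum_geometric_of_lt_one hρ0.le hρ1).mul_left
    ((1 + C) * ρ ^ N))) fun k => ?_).trans hNε.le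
  have h2 : ‖∑ j ∈ Finset.range N, ((ρ : ℂ) * ω ^ j) ^ (k + N) * L j‖ ≤ ρ ^ (k + N) * C := by
    calc _ ≤ ∑ j ∈ Finset.range N, ρ ^ (k + N) * ((N : ℝ)⁻¹ * C) := by
          refine norm_sum_le_of_le _ fun j _ => ?_
          rw [norm_mul, norm_pow, hw]
          gcongr
          exact hLbound j
      _ = ρ ^ (k + N) * C := by
          rw [Finset.sum_const, Finset.card_range, nsmul_eq_mul]
          field_simp
  calc _ ≤ 1 * (ρ ^ (k + N) + ρ ^ (k + N) * C) := by
        rw [norm_mul]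
        gcongr
        · exact ha1 _
        · refine (norm_sub_le _ _).trans (add_le_add ?_ h2)
          rw [norm_pow]
          gcongr
          linarith
    _ = (1 + C) * ρ ^ N * ρ ^ k := by ring

/-- Functions holomorphic on the polydisc and bounded by `1` are uniformly approximable by
polynomials on smaller polydiscs. -/
lemma exists_mvPolynomial_approx (d : ℕ) {r : ℝ} (hr0 : 0 ≤ r) (hr : r < 1) :
    ∀ {ε : ℝ}, 0 < ε → ∀ F : (Fin d → ℂ) → ℂ, DifferentiableOn ℂ F (polydisc d) →
      (∀ z ∈ polydisc d, ‖F z‖ ≤ 1) →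
      ∃ p : MvPolynomial (Fin d) ℂ, ∀ z : Fin d → ℂ, (∀ i, ‖z i‖ ≤ r) → ‖F z - eval z p‖ ≤ ε := by
  induction d with
  | zero =>
    intro ε hε F _ _
    refine ⟨C (F 0), fun z _ => ?_⟩
    simp [Subsingleton.elim z 0, hε.le]
  | succ d ih =>
    intro ε hε F hF hF1
    obtain ⟨N, w, L, hw, hL⟩ := exists_disc_interpolation hr0 hr (half_pos hε)
    have hcons : ∀ {u : ℂ} {z : Fin d → ℂ}, ‖u‖ < 1 → z ∈ polydisc d →
        (Fin.cons u z : Fin (d + 1) → ℂ) ∈ polydisc (d + 1) := by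
      intro u z hu hz i
      refine Fin.cases ?_ (fun i => ?_) i
      · simpa using hu
      · simpa using hz i
    obtain ⟨B, hB0, hB⟩ : ∃ B : ℝ, 0 < B ∧ ∀ j ∈ Finset.range N, ∀ z : ℂ, ‖z‖ ≤ r →
        ‖(L j).eval z‖ ≤ B := by
      have hj : ∀ j, ∃ B : ℝ, ∀ z : ℂ, ‖z‖ ≤ r → ‖(L j).eval z‖ ≤ B := fun j => by
        obtain ⟨B, hB⟩ := (isCompact_closedBall (0 : ℂ) r).exists_bound_of_continuousOn
          (L j).continuous.continuousOn
        exact ⟨B, fun z hz => hB z (by simpa using hz)⟩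
      choose B hB using hj
      refine ⟨∑ j ∈ Finset.range N, |B j| + 1, by positivity, fun j hj z hz => ?_⟩
      have := Finset.single_le_sum (f := fun j => |B j|) (fun i _ => abs_nonneg _) hj
      linarith [hB j z hz, le_abs_self (B j)]
    have hδ : 0 < ε / 2 / ((N + 1) * B) := by positivity
    have hP : ∀ j, ∃ p : MvPolynomial (Fin d) ℂ, ∀ z : Fin d → ℂ, (∀ i, ‖z i‖ ≤ r) →
        ‖F (Fin.cons (w j) z) - eval z p‖ ≤ ε / 2 / ((N + 1) * B) := by
      intro j
      refine ih hδ (fun z => F (Fin.cons (w j) z)) ?_ fun z hz => hF1 _ (hcons (hw j) hz)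
      refine hF.comp (Differentiable.differentiableOn ?_) fun z hz => hcons (hw j) hz
      rw [differentiable_pi]
      intro i
      refine Fin.cases ?_ (fun i => ?_) i
      · simp
      · simp only [Fin.cons_succ]
        fun_prop
    choose P hP using hP
    refine ⟨∑ j ∈ Finset.range N,
      rename Fin.succ (P j) * Polynomial.aeval (X 0 : MvPolynomial (Fin (d + 1)) ℂ) (L j),
      fun z hz => ?_⟩
    have heval : eval z (∑ j ∈ Finset.range N, rename Fin.succ (P j) *
        Polynomial.aeval (X 0 : MvPolynomial (Fin (d + 1)) ℂ) (L j)) =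
        ∑ j ∈ Finset.range N, eval (Fin.tail z) (P j) * (L j).eval (z 0) := by
      rw [map_sum]
      refine Finset.sum_congr rfl fun j _ => ?_
      rw [map_mul, eval_rename]
      congr 1
      rw [← MvPolynomial.coe_aeval_eq_eval, RingHom.coe_coe, ← Polynomial.aeval_algHom_apply]
      simp [Polynomial.aeval_def, Polynomial.eval₂_eq_eval_map]
    rw [heval]
    have htail : ∀ i, ‖Fin.tail z i‖ ≤ r := fun i => hz i.succ
    have hslice := hL (fun u => F (Fin.cons u (Fin.tail z))) ?_
      (fun u hu => hF1 _ (hcons (by simpa using hu) fun i => (htail i).trans_lt hr)) (z 0) (hz 0)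
    · simp only [Fin.cons_self_tail] at hslice
      calc _ = ‖(F z - ∑ j ∈ Finset.range N, F (Fin.cons (w j) (Fin.tail z)) * (L j).eval (z 0)) +
            ∑ j ∈ Finset.range N, (F (Fin.cons (w j) (Fin.tail z)) - eval (Fin.tail z) (P j)) *
              (L j).eval (z 0)‖ := by
            simp only [sub_mul, Finset.sum_sub_distrib]
            congr 1
            ring
        _ ≤ ε / 2 + ∑ j ∈ Finset.range N, ε / 2 / ((N + 1) * B) * B := by
            refine (norm_add_le _ _).trans (add_le_add hslice (norm_sum_le_of_le _ fun j hj => ?_))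
            rw [norm_mul]
            exact mul_le_mul (hP j _ htail) (hB j hj _ (hz 0)) (norm_nonneg _) hδ.le
        _ = ε / 2 + ε / 2 * (N / (N + 1)) := by
            rw [Finset.sum_const, Finset.card_range, nsmul_eq_mul]
            field_simp
        _ ≤ ε := by
            have : (N : ℝ) / (N + 1) ≤ 1 := (div_le_one (by positivity)).2 (by linarith)
            nlinarith
    · refine hF.comp (Differentiable.differentiableOn ?_)
        fun u hu => hcons (by simpa using hu) fun i => (htail i).trans_lt hr
      rw [differentiable_pi]
      intro i
      refine Fin.cases ?_ (fun i => ?_) i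
      · simp only [Fin.cons_zero]
        fun_prop
      · simp

/-- The maximum principle on the polydisc: a polynomial bounded on the torus is bounded by the
same constant on the closed polydisc. -/
lemma norm_eval_le_of_forall_mem_torus {d : ℕ} (p : MvPolynomial (Fin d) ℂ) {c : ℝ}
    (hp : ∀ z ∈ torus d, ‖eval z p‖ ≤ c) : ∀ z ∈ closedPolydisc d, ‖eval z p‖ ≤ c := by
  have key : ∀ s : Finset (Fin d), ∀ z ∈ closedPolydisc d, (∀ i ∉ s, ‖z i‖ = 1) →
      ‖eval z p‖ ≤ c := by
    intro s
    induction s using Finset.induction_on with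
    | empty => exact fun z _ h => hp z fun i => h i (Finset.notMem_empty i)
    | insert i s _ ih =>
      intro z hz h
      have hdiff : Differentiable ℂ fun u : ℂ => eval (Function.update z i u) p := by
        intro u
        refine ((AnalyticOnNhd.eval_mvPolynomial p _ (Set.mem_univ _)).differentiableAt).comp u
          (differentiableAt_pi.2 fun j => ?_)
        rcases eq_or_ne j i with rfl | hj
        · simp
        · simp [Function.update_of_ne hj]
      have hmax := Complex.norm_le_of_forall_mem_frontier_norm_le (C := c) (z := z i)
        Metric.isBounded_ball (hdiff.diffContOnCl (s := Metric.ball (0 : ℂ) 1)) ?_ ?_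
      · simpa using hmax
      · rw [frontier_ball _ one_ne_zero]
        intro u hu
        have hu : ‖u‖ = 1 := by simpa using hu
        refine ih _ (fun j => ?_) fun j hj => ?_
        · rcases eq_or_ne j i with rfl | hj
          · simp [hu]
          · simpa [Function.update_of_ne hj] using hz j
        · rcases eq_or_ne j i with rfl | hji
          · simp [hu]
          · simpa [Function.update_of_ne hji] using h j (by simp [hj, hji])
      · rw [closure_ball _ one_ne_zero]
        simpa using hz i
  exact fun z hz => key Finset.univ z hz (by simp)

/-- Every polynomial has a reflection `z ↦ (z₁⋯z_d)^N * conj (p (1 / conj z))` which is again a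
polynomial, provided `N` is large. -/
lemma exists_reflection {d : ℕ} (p : MvPolynomial (Fin d) ℂ) :
    ∃ N₀ : ℕ, ∀ N ≥ N₀, ∃ P : MvPolynomial (Fin d) ℂ, ∀ z : Fin d → ℂ, (∀ i, z i ≠ 0) →
      eval z P = (∏ i, z i) ^ N * star (eval (star z⁻¹) p) := by
  induction p using MvPolynomial.induction_on with
  | C a =>
    refine ⟨0, fun N _ => ⟨(∏ i, X i) ^ N * C (star a), fun z _ => ?_⟩⟩
    simp
  | add p q hp hq =>
    obtain ⟨M, hM⟩ := hp
    obtain ⟨K, hK⟩ := hq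
    refine ⟨max M K, fun N hN => ?_⟩
    obtain ⟨P, hP⟩ := hM N (le_of_max_le_left hN)
    obtain ⟨Q, hQ⟩ := hK N (le_of_max_le_right hN)
    refine ⟨P + Q, fun z hz => ?_⟩
    rw [map_add, map_add, star_add, hP z hz, hQ z hz, mul_add]
  | mul_X p i hp =>
    obtain ⟨M, hM⟩ := hp
    refine ⟨M + 1, fun N hN => ?_⟩
    obtain ⟨N, rfl⟩ : ∃ N', N = N' + 1 := ⟨N - 1, by omega⟩
    obtain ⟨P, hP⟩ := hM N (by omega)
    refine ⟨P * ∏ j ∈ Finset.univ.erase i, X j, fun z hz => ?_⟩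
    have hprod := Finset.mul_prod_erase Finset.univ z (Finset.mem_univ i)
    have hzi := hz i
    rw [map_mul, map_mul, hP z hz, map_prod]
    simp only [eval_X, star_mul', Pi.star_apply, Pi.inv_apply, star_star]
    rw [pow_succ, ← hprod]
    field_simp

/-- A matrix mapping the polydisc into itself has absolute row sums at most one. -/
lemma sum_norm_row_le_one {d : ℕ} {A : Matrix (Fin d) (Fin d) ℂ}
    (hA : ∀ z ∈ polydisc d, A *ᵥ z ∈ polydisc d) (i : Fin d) : ∑ j, ‖A i j‖ ≤ 1 := by
  have h : ∀ t ∈ Set.Ioo (0 : ℝ) 1, t * ∑ j, ‖A i j‖ ≤ 1 := by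
    rintro t ⟨ht0, ht1⟩
    set v : Fin d → ℂ := fun j => t * (star (A i j) / ‖A i j‖) with hv
    have hvmem : v ∈ polydisc d := by
      intro j
      rw [hv]
      simp only [norm_mul, norm_div, norm_star, Complex.norm_real, Real.norm_eq_abs, abs_norm,
        abs_of_pos ht0]
      exact (mul_le_of_le_one_right ht0.le (div_self_le_one _)).trans_lt ht1
    have hval : (A *ᵥ v) i = ((t * ∑ j, ‖A i j‖ : ℝ) : ℂ) := by
      rw [mulVec, dotProduct]
      push_cast
      rw [Finset.mul_sum]
      refine Finset.sum_congr rfl fun j _ => ?_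
      rcases eq_or_ne (A i j) 0 with h0 | h0
      · simp [hv, h0]
      · have hn : (‖A i j‖ : ℂ) ≠ 0 := by simpa using h0
        have hmul : A i j * star (A i j) = (‖A i j‖ : ℂ) ^ 2 := by
          simpa using Complex.mul_conj' (A i j)
        rw [hv]
        field_simp
        linear_combination (t : ℂ) * hmul
    have := hA v hvmem i
    rw [hval, Complex.norm_real] at this
    exact (le_abs_self _).trans this.le
  have hlim : Tendsto (fun t : ℝ => t * ∑ j, ‖A i j‖) (𝓝[<] 1) (𝓝 (1 * ∑ j, ‖A i j‖)) :=
    ((continuous_id.mul continuous_const).tendsto 1).mono_left nhdsWithin_le_nhds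
  rw [one_mul] at hlim
  exact le_of_tendsto hlim (Filter.mem_of_superset (Ioo_mem_nhdsLT zero_lt_one) h)

/-- An invertible matrix mapping the polydisc onto itself is a monomial matrix with unimodular
coefficients. -/
lemma exists_perm_of_image_polydisc {d : ℕ} (A : GL (Fin d) ℂ)
    (hA : (fun z => (A : Matrix (Fin d) (Fin d) ℂ) *ᵥ z) '' polydisc d = polydisc d) :
    ∃ (τ : Equiv.Perm (Fin d)) (c : Fin d → ℂ), (∀ i, ‖c i‖ = 1) ∧
      ∀ z i, ((A : Matrix (Fin d) (Fin d) ℂ) *ᵥ z) i = c i * z (τ i) := by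
  have hmaps : ∀ z ∈ polydisc d, (A : Matrix (Fin d) (Fin d) ℂ) *ᵥ z ∈ polydisc d :=
    fun z hz => hA ▸ Set.mem_image_of_mem _ hz
  have hmaps' : ∀ z ∈ polydisc d, ((A⁻¹ : GL (Fin d) ℂ) : Matrix (Fin d) (Fin d) ℂ) *ᵥ z ∈
      polydisc d := by
    intro z hz
    rw [← hA] at hz
    obtain ⟨w, hw, rfl⟩ := hz
    simpa [mulVec_mulVec, ← Units.val_mul] using hw
  set M : Matrix (Fin d) (Fin d) ℂ := (A : Matrix (Fin d) (Fin d) ℂ) with hM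
  have hrow := sum_norm_row_le_one hmaps
  have hrow' := sum_norm_row_le_one hmaps'
  have hle : ∀ i j, ‖M i j‖ ≤ 1 := fun i j =>
    (Finset.single_le_sum (f := fun j => ‖M i j‖) (fun _ _ => norm_nonneg _)
      (Finset.mem_univ j)).trans (hrow i)
  have hcol : ∀ j, ∃ i, ‖M i j‖ = 1 := by
    intro j
    by_contra! hlt
    have hlt : ∀ i, ‖M i j‖ < 1 := fun i => lt_of_le_of_ne (hle i j) (hlt i)
    have hone : ∑ i, ((A⁻¹ : GL (Fin d) ℂ) : Matrix (Fin d) (Fin d) ℂ) j i * M i j = 1 := by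
      rw [← Matrix.mul_apply, hM, ← Units.val_mul, inv_mul_cancel, Units.val_one,
        Matrix.one_apply_eq]
    set B := ((A⁻¹ : GL (Fin d) ℂ) : Matrix (Fin d) (Fin d) ℂ) with hB
    obtain ⟨i₀, -, hi₀⟩ : ∃ i ∈ Finset.univ, B j i * M i j ≠ 0 :=
      Finset.exists_ne_zero_of_sum_ne_zero (by rw [hone]; exact one_ne_zero)
    have : (1 : ℝ) < 1 := calc
      (1 : ℝ) = ‖∑ i, B j i * M i j‖ := by rw [hone, norm_one]
      _ ≤ ∑ i, ‖B j i‖ * ‖M i j‖ := norm_sum_le_of_le _ fun i _ => (norm_mul _ _).le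
      _ < ∑ i, ‖B j i‖ := by
        refine Finset.sum_lt_sum
          (fun i _ => mul_le_of_le_one_right (norm_nonneg _) (hle i j)) ⟨i₀, Finset.mem_univ _, ?_⟩
        exact mul_lt_of_lt_one_right (norm_pos_iff.2 (left_ne_zero_of_mul hi₀)) (hlt i₀)
      _ ≤ 1 := hrow' j
    exact lt_irrefl _ this
  choose π hπ using hcol
  have hzero : ∀ j k, k ≠ j → M (π j) k = 0 := by
    intro j k hk
    have h2 := Finset.add_le_sum (f := fun k => ‖M (π j) k‖) (fun _ _ => norm_nonneg _)
      (Finset.mem_univ j) (Finset.mem_univ k) hk.symm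
    have := hrow (π j)
    rw [← norm_le_zero_iff]
    simp only [hπ] at h2
    linarith
  have hinj : Function.Injective π := by
    intro j k hjk
    by_contra hne
    have h0 := hzero j k (Ne.symm hne)
    have h1 := hπ k
    rw [← hjk, h0, norm_zero] at h1
    exact zero_ne_one h1
  let e : Equiv.Perm (Fin d) := Equiv.ofBijective π (Finite.injective_iff_bijective.1 hinj)
  have he : ∀ i, π (e.symm i) = i := e.apply_symm_apply
  refine ⟨e.symm, fun i => M i (e.symm i), fun i => ?_, fun z i => ?_⟩
  · simpa only [he] using hπ (e.symm i)
  · rw [mulVec, dotProduct]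
    refine Finset.sum_eq_single_of_mem _ (Finset.mem_univ _) fun k _ hk => ?_
    have := hzero (e.symm i) k hk
    rw [he] at this
    rw [this, zero_mul]

/-- Points with nonzero coordinates are dense. -/
lemma dense_forall_ne_zero (d : ℕ) : Dense {z : Fin d → ℂ | ∀ i, z i ≠ 0} := by
  convert dense_pi Set.univ fun (_ : Fin d) _ => dense_compl_singleton (0 : ℂ) using 1
  ext z
  simp

/-- A suitable power of the product of the coordinates is invariant under a finite group of
monomial transformations. -/
lemma prod_mulVec_pow_card {d : ℕ} (G : Subgroup (GL (Fin d) ℂ)) [Finite G]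
    (hGD : ∀ σ : G,
      (fun z => Matrix.mulVec (((σ : GL (Fin d) ℂ) : Matrix (Fin d) (Fin d) ℂ)) z) ''
        polydisc d = polydisc d) (σ : G) (z : Fin d → ℂ) :
    (∏ i, (((σ : GL (Fin d) ℂ) : Matrix (Fin d) (Fin d) ℂ) *ᵥ z) i) ^ Nat.card G =
      (∏ i, z i) ^ Nat.card G := by
  obtain ⟨τ, c, -, hc⟩ := exists_perm_of_image_polydisc (σ : GL (Fin d) ℂ) (hGD σ)
  have hstep : ∀ z : Fin d → ℂ, ∏ i, (((σ : GL (Fin d) ℂ) : Matrix (Fin d) (Fin d) ℂ) *ᵥ z) i =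
      (∏ i, c i) * ∏ i, z i := fun z => by
    simp only [hc, Finset.prod_mul_distrib, Equiv.prod_comp τ z]
  have hiter : ∀ n : ℕ, ∀ z : Fin d → ℂ,
      ∏ i, ((((σ ^ n : G) : GL (Fin d) ℂ) : Matrix (Fin d) (Fin d) ℂ) *ᵥ z) i =
        (∏ i, c i) ^ n * ∏ i, z i := by
    intro n
    induction n with
    | zero => simp
    | succ n ih =>
      intro z
      rw [pow_succ, Subgroup.coe_mul, Units.val_mul, ← mulVec_mulVec, ih, hstep, pow_succ,
        mul_assoc]
  have h := hiter (Nat.card G) (fun _ => 1)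
  rw [pow_card_eq_one'] at h
  simp only [Subgroup.coe_one, Units.val_one, one_mulVec, Finset.prod_const_one, mul_one] at h
  rw [hstep, mul_pow, ← h, one_mul]

/-- Functions holomorphic on the polydisc and bounded by `1` are approximated on smaller polydiscs
by polynomials with supremum norm on the closed polydisc less than `1`. -/
lemma exists_mvPolynomial_approx_norm_lt_one {d : ℕ} {F : (Fin d → ℂ) → ℂ}
    (hF : DifferentiableOn ℂ F (polydisc d)) (hF1 : ∀ z ∈ polydisc d, ‖F z‖ ≤ 1)
    {r : ℝ} (hr0 : 0 ≤ r) (hr : r < 1) {ε : ℝ} (hε : 0 < ε) :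
    ∃ (p : MvPolynomial (Fin d) ℂ) (c : ℝ), c < 1 ∧
      (∀ z ∈ closedPolydisc d, ‖eval z p‖ ≤ c) ∧
      ∀ z : Fin d → ℂ, (∀ i, ‖z i‖ ≤ r) → ‖F z - eval z p‖ ≤ ε := by
  have hsub : Metric.closedBall (0 : Fin d → ℂ) r ⊆ polydisc d := fun z hz i =>
    ((norm_le_pi_norm z i).trans (by simpa using hz)).trans_lt hr
  obtain ⟨δ, hδ, hunif⟩ := Metric.uniformContinuousOn_iff.1
    ((isCompact_closedBall _ r).uniformContinuousOn_of_continuous (hF.continuousOn.mono hsub))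
    (ε / 2) (half_pos hε)
  obtain ⟨s, hs0, hs1, hsδ⟩ : ∃ s : ℝ, 0 ≤ s ∧ s < 1 ∧ 1 - s < δ :=
    ⟨max 0 (1 - δ / 2), le_max_left _ _, max_lt one_pos (by linarith),
      by linarith [le_max_right 0 (1 - δ / 2)]⟩
  set η := ε / 6 with hη
  have hη0 : 0 < η := by positivity
  obtain ⟨q, hq⟩ := exists_mvPolynomial_approx d hs0 hs1 hη0 F hF hF1
  have heval : ∀ z : Fin d → ℂ, eval z (bind₁ (fun i => C (s : ℂ) * X i) q) =
      eval (fun i => (s : ℂ) * z i) q := by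
    intro z
    simp only [← coe_aeval_eq_eval, RingHom.coe_coe, aeval_bind₁]
    simp
  have hsz : ∀ z ∈ closedPolydisc d, ∀ i, ‖(s : ℂ) * z i‖ ≤ s := fun z hz i => by
    rw [norm_mul, Complex.norm_real, Real.norm_of_nonneg hs0]
    exact mul_le_of_le_one_right hs0 (hz i)
  have hbound : ∀ z ∈ closedPolydisc d, ‖eval (fun i => (s : ℂ) * z i) q‖ ≤ 1 + η := by
    intro z hz
    have h1 := hq _ (hsz z hz)
    have h2 := hF1 _ fun i => (hsz z hz i).trans_lt hs1
    have h3 := norm_le_insert (F fun i => (s : ℂ) * z i) (eval (fun i => (s : ℂ) * z i) q)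
    linarith
  refine ⟨C ((1 + 2 * η : ℝ) : ℂ)⁻¹ * bind₁ (fun i => C (s : ℂ) * X i) q,
    (1 + η) / (1 + 2 * η), (div_lt_one (by positivity)).2 (by linarith),
    fun z hz => ?_, fun z hz => ?_⟩
  · rw [map_mul, eval_C, heval, norm_mul, norm_inv, Complex.norm_real,
      Real.norm_of_nonneg (by positivity), div_eq_inv_mul]
    gcongr
    exact hbound z hz
  · have hz1 : z ∈ closedPolydisc d := fun i => (hz i).trans hr.le
    have h1 := hq _ (hsz z hz1)
    have h2 := hbound z hz1
    have h3 : ‖F z - F fun i => (s : ℂ) * z i‖ ≤ ε / 2 := by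
      rw [← dist_eq_norm]
      refine (hunif z ?_ _ ?_ ?_).le
      · simpa using (pi_norm_le_iff_of_nonneg hr0).2 hz
      · simp only [mem_closedBall_zero_iff, pi_norm_le_iff_of_nonneg hr0]
        intro i
        rw [norm_mul, Complex.norm_real, Real.norm_of_nonneg hs0]
        exact (mul_le_of_le_one_left (norm_nonneg _) hs1.le).trans (hz i)
      · refine (dist_pi_lt_iff hδ).2 fun i => ?_
        have : z i - s * z i = ((1 - s : ℝ) : ℂ) * z i := by push_cast; ring
        rw [dist_eq_norm, this, norm_mul, Complex.norm_real, Real.norm_of_nonneg (by linarith)]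
        exact (mul_le_of_le_one_right (by linarith) (hz1 i)).trans_lt hsδ
    rw [map_mul, eval_C, heval]
    set w := eval (fun i => (s : ℂ) * z i) q
    have h4 : ‖w - ((1 + 2 * η : ℝ) : ℂ)⁻¹ * w‖ ≤ 2 * η := by
      have hpos : 0 < 1 + 2 * η := by positivity
      have : w - ((1 + 2 * η : ℝ) : ℂ)⁻¹ * w = ((2 * η * (1 + 2 * η)⁻¹ : ℝ) : ℂ) * w := by
        have hne : ((1 + 2 * η : ℝ) : ℂ) ≠ 0 := by exact_mod_cast hpos.ne'
        rw [Complex.ofReal_mul, Complex.ofReal_inv]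
        field_simp
        push_cast
        ring
      rw [this, norm_mul, Complex.norm_real, Real.norm_of_nonneg (by positivity), mul_assoc]
      refine mul_le_of_le_one_right (by positivity) ?_
      rw [inv_mul_le_iff₀ hpos]
      linarith
    have h5 := norm_add₃_le (a := F z - F fun i => (s : ℂ) * z i)
      (b := (F fun i => (s : ℂ) * z i) - w) (c := w - ((1 + 2 * η : ℝ) : ℂ)⁻¹ * w)
    rw [sub_add_sub_cancel, sub_add_sub_cancel] at h5
    linarith

/-- Averaging over a finite group turns polynomial approximants of an invariant function into
invariant ones. -/
lemma exists_invariant_mvPolynomial {d : ℕ} (G : Subgroup (GL (Fin d) ℂ)) [Finite G]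
    {S T : Set (Fin d → ℂ)}
    (hS : ∀ σ : G, ∀ z ∈ S, ((σ : GL (Fin d) ℂ) : Matrix (Fin d) (Fin d) ℂ) *ᵥ z ∈ S)
    (hT : ∀ σ : G, ∀ z ∈ T, ((σ : GL (Fin d) ℂ) : Matrix (Fin d) (Fin d) ℂ) *ᵥ z ∈ T)
    {F : (Fin d → ℂ) → ℂ}
    (hF : ∀ σ : G, ∀ z ∈ T, F (((σ : GL (Fin d) ℂ) : Matrix (Fin d) (Fin d) ℂ) *ᵥ z) = F z)
    {p : MvPolynomial (Fin d) ℂ} {c ε : ℝ} (hp : ∀ z ∈ S, ‖eval z p‖ ≤ c)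
    (hpF : ∀ z ∈ T, ‖F z - eval z p‖ ≤ ε) :
    ∃ P : MvPolynomial (Fin d) ℂ,
      (∀ σ : G, ∀ z, eval (((σ : GL (Fin d) ℂ) : Matrix (Fin d) (Fin d) ℂ) *ᵥ z) P = eval z P) ∧
      (∀ z ∈ S, ‖eval z P‖ ≤ c) ∧ ∀ z ∈ T, ‖F z - eval z P‖ ≤ ε := by
  have := Fintype.ofFinite G
  set n : ℂ := ((Fintype.card G : ℕ) : ℂ) with hn
  have hn0 : n ≠ 0 := by simp [hn]
  have havg : ∀ {f : G → ℂ} {b : ℝ}, (∀ σ, ‖f σ‖ ≤ b) → ‖n⁻¹ * ∑ σ, f σ‖ ≤ b := by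
    intro f b hf
    rw [norm_mul, norm_inv, inv_mul_le_iff₀ (norm_pos_iff.2 hn0), hn, Complex.norm_natCast]
    simpa using norm_sum_le_of_le Finset.univ fun σ _ => hf σ
  let P : MvPolynomial (Fin d) ℂ := C n⁻¹ * ∑ σ : G,
    bind₁ (fun i => ∑ j, C (((σ : GL (Fin d) ℂ) : Matrix (Fin d) (Fin d) ℂ) i j) * X j) p
  have hP : ∀ z, eval z P = n⁻¹ * ∑ σ : G,
      eval (((σ : GL (Fin d) ℂ) : Matrix (Fin d) (Fin d) ℂ) *ᵥ z) p := by
    intro z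
    rw [map_mul, eval_C, map_sum]
    congr 1
    refine Finset.sum_congr rfl fun σ _ => ?_
    simp only [← coe_aeval_eq_eval, RingHom.coe_coe, aeval_bind₁]
    simp only [map_sum, map_mul, aeval_X, aeval_C, Algebra.algebraMap_self, RingHom.id_apply]
    rfl
  refine ⟨P, fun σ z => ?_, fun z hz => ?_, fun z hz => ?_⟩
  · rw [hP, hP]
    congr 1
    refine Fintype.sum_equiv (Equiv.mulRight σ) _ _ fun τ => ?_
    rw [mulVec_mulVec, Equiv.coe_mulRight, Subgroup.coe_mul, Units.val_mul]
  · rw [hP]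
    exact havg fun σ => hp _ (hS σ z hz)
  · have : F z - eval z P = n⁻¹ * ∑ σ : G,
        (F (((σ : GL (Fin d) ℂ) : Matrix (Fin d) (Fin d) ℂ) *ᵥ z) -
          eval (((σ : GL (Fin d) ℂ) : Matrix (Fin d) (Fin d) ℂ) *ᵥ z) p) := by
      rw [hP, Finset.sum_sub_distrib, mul_sub, Finset.sum_congr rfl fun σ _ => hF σ z hz]
      simp [hn]
    rw [this]
    exact havg fun σ => hpF _ (hT σ z hz)

/-- An invariant polynomial with supremum norm less than `1` on the closed polydisc is uniformly
approximated by invariant rational inner functions on smaller polydiscs. -/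
lemma exists_invariant_rationalInner_approx {d : ℕ} (hd : d ≠ 0)
    (G : Subgroup (GL (Fin d) ℂ)) [Finite G]
    (hGD : ∀ σ : G,
      (fun z => Matrix.mulVec (((σ : GL (Fin d) ℂ) : Matrix (Fin d) (Fin d) ℂ)) z) ''
        polydisc d = polydisc d)
    {p : MvPolynomial (Fin d) ℂ} {c : ℝ} (hc1 : c < 1)
    (hp : ∀ z ∈ closedPolydisc d, ‖eval z p‖ ≤ c)
    (hpG : ∀ σ : G, ∀ z,
      eval (((σ : GL (Fin d) ℂ) : Matrix (Fin d) (Fin d) ℂ) *ᵥ z) p = eval z p)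
    {r : ℝ} (hr0 : 0 ≤ r) (hr : r < 1) {ε : ℝ} (hε : 0 < ε) :
    ∃ h : (Fin d → ℂ) → ℂ, IsRationalInner h ∧
      (∀ σ : G, ∀ z, h (((σ : GL (Fin d) ℂ) : Matrix (Fin d) (Fin d) ℂ) *ᵥ z) = h z) ∧
      ∀ z : Fin d → ℂ, (∀ i, ‖z i‖ ≤ r) → ‖h z - eval z p‖ ≤ ε := by
  have hn1 : 1 ≤ Nat.card G := Nat.card_pos
  set n := Nat.card G with hn
  obtain ⟨N, hN⟩ := exists_reflection p
  obtain ⟨P, hP⟩ := hN (n * N) (Nat.le_mul_of_pos_left N hn1)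
  have hMG : ∀ k : ℕ, ∀ σ : G, ∀ z : Fin d → ℂ,
      (∏ i, (((σ : GL (Fin d) ℂ) : Matrix (Fin d) (Fin d) ℂ) *ᵥ z) i) ^ (n * k) =
        (∏ i, z i) ^ (n * k) := fun k σ z => by
    rw [pow_mul, pow_mul, prod_mulVec_pow_card G hGD]
  have hPG : ∀ σ : G, ∀ z,
      eval (((σ : GL (Fin d) ℂ) : Matrix (Fin d) (Fin d) ℂ) *ᵥ z) P = eval z P := by
    intro σ
    refine congr_fun (Continuous.ext_on (dense_forall_ne_zero d) ?_ (continuous_eval P)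
      fun z hz => ?_)
    · exact (continuous_eval P).comp (continuous_const.matrix_mulVec continuous_id)
    obtain ⟨τ, a, ha, hσ⟩ := exists_perm_of_image_polydisc (σ : GL (Fin d) ℂ) (hGD σ)
    have ha0 : ∀ i, a i ≠ 0 := fun i => norm_ne_zero_iff.1 (by rw [ha i]; exact one_ne_zero)
    have hstar : star (((σ : GL (Fin d) ℂ) : Matrix (Fin d) (Fin d) ℂ) *ᵥ z)⁻¹ =
        ((σ : GL (Fin d) ℂ) : Matrix (Fin d) (Fin d) ℂ) *ᵥ star z⁻¹ := by
      ext i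
      have hai : star (a i)⁻¹ = a i := by
        rw [Complex.inv_eq_conj (ha i)]
        simp
      rw [hσ]
      simp only [Pi.star_apply, Pi.inv_apply, hσ, mul_inv, star_mul', hai]
    rw [hP z hz, hP _ fun i => by rw [hσ]; exact mul_ne_zero (ha0 i) (hz _), hMG, hstar, hpG]
  have hinv : ∀ z ∈ torus d, star z⁻¹ = z := by
    intro z hz
    ext i
    rw [Pi.star_apply, Pi.inv_apply, Complex.inv_eq_conj (hz i)]
    simp
  have hprod : ∀ z ∈ torus d, ‖∏ i, z i‖ = 1 := fun z hz => by
    rw [norm_prod, Finset.prod_eq_one fun i _ => hz i]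
  have hPtorus : ∀ z ∈ torus d, eval z P = (∏ i, z i) ^ (n * N) * star (eval z p) := by
    intro z hz
    rw [hP z fun i => norm_ne_zero_iff.1 (by rw [hz i]; exact one_ne_zero), hinv z hz]
  have hPc : ∀ z ∈ closedPolydisc d, ‖eval z P‖ ≤ c := by
    refine norm_eval_le_of_forall_mem_torus P fun z hz => ?_
    rw [hPtorus z hz, norm_mul, norm_pow, hprod z hz, one_pow, one_mul, norm_star]
    exact hp z fun i => (hz i).le
  have hprodle : ∀ z ∈ closedPolydisc d, ‖∏ i, z i‖ ≤ 1 := fun z hz => by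
    rw [norm_prod]
    exact Finset.prod_le_one (fun _ _ => norm_nonneg _) fun i _ => hz i
  obtain ⟨k, hk⟩ : ∃ k : ℕ, r ^ k < ε * (1 - c) / 2 :=
    exists_pow_lt_of_lt_one (by have := sub_pos.2 hc1; positivity) hr
  have hden : ∀ z ∈ closedPolydisc d, ‖(∏ i, z i) ^ (n * k) * eval z P‖ ≤ c := fun z hz => by
    rw [norm_mul, norm_pow]
    exact (mul_le_of_le_one_left (norm_nonneg _) (pow_le_one₀ (norm_nonneg _) (hprodle z hz))).trans
      (hPc z hz)
  have hden' : ∀ z ∈ closedPolydisc d, 1 - c ≤ ‖1 + (∏ i, z i) ^ (n * k) * eval z P‖ := by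
    intro z hz
    have h := norm_sub_le (1 + (∏ i, z i) ^ (n * k) * eval z P) ((∏ i, z i) ^ (n * k) * eval z P)
    rw [add_sub_cancel_right, norm_one] at h
    linarith [hden z hz]
  have hne : ∀ z ∈ closedPolydisc d, 1 + (∏ i, z i) ^ (n * k) * eval z P ≠ 0 := fun z hz =>
    norm_pos_iff.1 ((sub_pos.2 hc1).trans_le (hden' z hz))
  set A : MvPolynomial (Fin d) ℂ := p + (∏ i, X i) ^ (n * (N + k)) with hA
  set B : MvPolynomial (Fin d) ℂ := 1 + (∏ i, X i) ^ (n * k) * P with hB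
  have hAe : ∀ z, eval z A = eval z p + (∏ i, z i) ^ (n * (N + k)) := fun z => by simp [hA]
  have hBe : ∀ z, eval z B = 1 + (∏ i, z i) ^ (n * k) * eval z P := fun z => by simp [hB]
  refine ⟨fun z => eval z A / eval z B, ⟨A, B, {z | eval z B ≠ 0},
    isOpen_ne_fun (continuous_eval B) continuous_const, fun z hz => ?_, fun z hz => ⟨hz, rfl⟩,
    fun z hz => ?_⟩, fun σ z => ?_, fun z hz => ?_⟩
  · rw [Set.mem_ofPred_eq, hBe]
    exact hne z hz
  · have hz1 : z ∈ closedPolydisc d := fun i => (hz i).le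
    have hm : ∀ m : ℕ, ‖(∏ i, z i) ^ m‖ = 1 := fun m => by rw [norm_pow, hprod z hz, one_pow]
    have hmm := Complex.mul_conj' ((∏ i, z i) ^ (n * (N + k)))
    rw [hm, Complex.ofReal_one, one_pow] at hmm
    have hrefl : eval z B = (∏ i, z i) ^ (n * (N + k)) * star (eval z A) := by
      rw [hBe, hAe, hPtorus z hz, star_add, mul_add]
      change _ = _ + _ * (starRingEnd ℂ) _
      rw [hmm, mul_add n, pow_add]
      ring
    have hB0 : eval z B ≠ 0 := by
      rw [hBe]
      exact hne z hz1
    have hnorm : ‖eval z A‖ = ‖eval z B‖ := by rw [hrefl, norm_mul, hm, one_mul, norm_star]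
    rw [norm_div, hnorm, div_self (norm_ne_zero_iff.2 hB0)]
  · simp only [hAe, hBe, hMG, hPG, hpG]
  · have hz1 : z ∈ closedPolydisc d := fun i => (hz i).trans hr.le
    have hprodr : ‖∏ i, z i‖ ≤ r := by
      have : NeZero d := ⟨hd⟩
      rw [norm_prod, ← Finset.mul_prod_erase _ _ (Finset.mem_univ 0)]
      exact (mul_le_of_le_one_right (norm_nonneg _)
        (Finset.prod_le_one (fun _ _ => norm_nonneg _) fun i _ => hz1 i)).trans (hz 0)
    have hpow : ∀ m, k ≤ m → ‖(∏ i, z i) ^ m‖ ≤ r ^ k := fun m hm => by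
      rw [norm_pow]
      exact (pow_le_pow_left₀ (norm_nonneg _) hprodr m).trans (pow_le_pow_of_le_one hr0 hr.le hm)
    have hdiff : eval z A / eval z B - eval z p =
        ((∏ i, z i) ^ (n * (N + k)) - eval z p * ((∏ i, z i) ^ (n * k) * eval z P)) /
          (1 + (∏ i, z i) ^ (n * k) * eval z P) := by
      rw [hAe, hBe, div_sub' (hne z hz1)]
      ring
    rw [hdiff, norm_div, div_le_iff₀ ((sub_pos.2 hc1).trans_le (hden' z hz1))]
    have h1 := hpow (n * (N + k)) (by nlinarith)
    have h2 : ‖eval z p * ((∏ i, z i) ^ (n * k) * eval z P)‖ ≤ r ^ k := by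
      rw [norm_mul, norm_mul]
      refine (mul_le_of_le_one_left (by positivity) ((hp z hz1).trans hc1.le)).trans ?_
      exact (mul_le_of_le_one_right (norm_nonneg _) ((hPc z hz1).trans hc1.le)).trans
        (hpow (n * k) (by nlinarith))
    have h3 := norm_sub_le ((∏ i, z i) ^ (n * (N + k)))
      (eval z p * ((∏ i, z i) ^ (n * k) * eval z P))
    have h4 := mul_le_mul_of_nonneg_left (hden' z hz1) hε.le
    linarith

/-- Carathéodory approximation on quotient domains of the polydisc.
Let `G` be a finite pseudo-reflection subgroup of `GL_d(ℂ)` each of whose elements maps the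
polydisc onto itself.  Every `G`-invariant holomorphic function `F` on `𝔻^d` bounded by `1` can
be approximated uniformly on compact subsets of `𝔻^d` by `G`-invariant rational inner
functions. -/
theorem caratheodory_approximation {d : ℕ} (hd : 2 ≤ d)
    (G : Subgroup (GL (Fin d) ℂ)) (hGfin : Finite G)
    (hGgen : ∃ S : Set (GL (Fin d) ℂ), S ⊆ (G : Set (GL (Fin d) ℂ)) ∧
      Subgroup.closure S = G ∧
      ∀ σ ∈ S, ((1 - ((σ : GL (Fin d) ℂ) : Matrix (Fin d) (Fin d) ℂ)).rank = 1 ∧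
        ∃ n : ℕ, 0 < n ∧ σ ^ n = 1))
    (hGD : ∀ σ : G,
      (fun z => Matrix.mulVec (((σ : GL (Fin d) ℂ) : Matrix (Fin d) (Fin d) ℂ)) z) ''
        polydisc d = polydisc d)
    (F : (Fin d → ℂ) → ℂ)
    (hF : DifferentiableOn ℂ F (polydisc d))
    (hF1 : ∀ z ∈ polydisc d, ‖F z‖ ≤ 1)
    (hFinv : ∀ σ : G, ∀ z ∈ polydisc d,
      F (Matrix.mulVec (((σ : GL (Fin d) ℂ) : Matrix (Fin d) (Fin d) ℂ)) z) = F z) :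
    ∃ h : ℕ → ((Fin d → ℂ) → ℂ),
      (∀ j, IsRationalInner (h j) ∧
        ∀ σ : G, ∀ z ∈ closedPolydisc d,
          h j (Matrix.mulVec (((σ : GL (Fin d) ℂ) : Matrix (Fin d) (Fin d) ℂ)) z) = h j z) ∧
      (∀ K ⊆ polydisc d, IsCompact K → TendstoUniformlyOn (fun j => h j) F atTop K) := by
  have hmon := fun σ : G => exists_perm_of_image_polydisc (σ : GL (Fin d) ℂ) (hGD σ)
  have hstable : ∀ (R : ℝ) (σ : G), ∀ z ∈ {z : Fin d → ℂ | ∀ i, ‖z i‖ ≤ R},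
      ((σ : GL (Fin d) ℂ) : Matrix (Fin d) (Fin d) ℂ) *ᵥ z ∈
        {z : Fin d → ℂ | ∀ i, ‖z i‖ ≤ R} := by
    intro R σ z hz i
    obtain ⟨τ, c, hc, hσ⟩ := hmon σ
    rw [hσ, norm_mul, hc, one_mul]
    exact hz _
  have happrox : ∀ r : ℝ, 0 ≤ r → r < 1 → ∀ ε : ℝ, 0 < ε → ∃ h : (Fin d → ℂ) → ℂ,
      IsRationalInner h ∧
      (∀ σ : G, ∀ z, h (((σ : GL (Fin d) ℂ) : Matrix (Fin d) (Fin d) ℂ) *ᵥ z) = h z) ∧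
      ∀ z : Fin d → ℂ, (∀ i, ‖z i‖ ≤ r) → ‖F z - h z‖ ≤ ε := by
    intro r hr0 hr ε hε
    obtain ⟨q, c, hc1, hq, hqF⟩ :=
      exists_mvPolynomial_approx_norm_lt_one hF hF1 hr0 hr (half_pos hε)
    obtain ⟨p, hpG, hp, hpF⟩ := exists_invariant_mvPolynomial G (S := closedPolydisc d)
      (T := {z | ∀ i, ‖z i‖ ≤ r}) (hstable 1) (hstable r)
      (fun σ z hz => hFinv σ z fun i => (hz i).trans_lt hr) hq hqF
    obtain ⟨h, hh, hhG, hhp⟩ := exists_invariant_rationalInner_approx (by omega) G hGD hc1 hp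
      hpG hr0 hr (half_pos hε)
    refine ⟨h, hh, hhG, fun z hz => ?_⟩
    have h1 := norm_sub_le_norm_sub_add_norm_sub (F z) (eval z p) (h z)
    have h2 := hpF z hz
    have h3 := hhp z hz
    rw [norm_sub_rev] at h3
    linarith
  have hseq : ∀ j : ℕ, (0 : ℝ) < 1 / ((j : ℝ) + 1) := fun j => Nat.one_div_pos_of_nat
  have hseq1 : ∀ j : ℕ, 1 / ((j : ℝ) + 1) ≤ 1 := fun j =>
    (div_le_one (by positivity)).2 (by linarith [j.cast_nonneg (α := ℝ)])
  choose h hh hhG hhF using fun j : ℕ => happrox (1 - 1 / ((j : ℝ) + 1))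
    (sub_nonneg.2 (hseq1 j)) (sub_lt_self _ (hseq j)) (1 / ((j : ℝ) + 1)) (hseq j)
  refine ⟨h, fun j => ⟨hh j, fun σ z _ => hhG j σ z⟩, fun K hK hKc => ?_⟩
  obtain ⟨R, hR1, hKR⟩ : ∃ R < (1 : ℝ), ∀ z ∈ K, ‖z‖ ≤ R := by
    rcases K.eq_empty_or_nonempty with rfl | hKne
    · exact ⟨0, one_pos, by simp⟩
    · obtain ⟨w, hw, hmax⟩ := hKc.exists_isMaxOn hKne continuous_norm.continuousOn
      exact ⟨‖w‖, (pi_norm_lt_iff one_pos).2 (hK hw), fun z hz => hmax hz⟩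
  rw [Metric.tendstoUniformlyOn_iff]
  intro ε hε
  have hlim : ∀ δ : ℝ, 0 < δ → ∀ᶠ j : ℕ in atTop, 1 / ((j : ℝ) + 1) < δ := fun δ hδ =>
    tendsto_one_div_add_atTop_nhds_zero_nat.eventually (gt_mem_nhds hδ)
  filter_upwards [hlim ε hε, hlim (1 - R) (sub_pos.2 hR1)] with j hj1 hj2 z hz
  rw [dist_eq_norm]
  refine (hhF j z fun i => ?_).trans_lt hj1
  linarith [norm_le_pi_norm z i, hKR z hz]

end
end

section
/- Let k ≥ 1 and l ≥ 0 be integers and let α₁,…,α_p and β₁,…,β_q be unimodular complex numbers all different from 1. Define φ ∈ L²(𝕋) by the L²-convergent series φ(ζ) = k·Σ_{n≥1} n^{-1}ζ^n + Σ_{i=1}^p Σ_{n≥1} n^{-1}α_i^n ζ^n + l·Σ_{n≥1} n^{-1} conj(ζ)^n + Σ_{j=1}^q Σ_{n≥1} n^{-1}β_j^n conj(ζ)^n. Then φ is not essentially bounded: there is no constant c with |φ| ≤ c almost everywhere on 𝕋 (and likewise φ + a is not essentially bounded for any constant a ∈ ℂ). -/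
open MeasureTheory Filter Topology ComplexConjugate

noncomputable section

/-- The Haar probability measure on the unit circle `𝕋 ⊂ ℂ`: the push-forward of Lebesgue
measure on `[0,1)` under `x ↦ e^{2πi x}`. -/
def circleMeasure : Measure ℂ :=
  Measure.map (fun x : ℝ => Complex.exp (2 * Real.pi * Complex.I * x))
    (volume.restrict (Set.Ico (0:ℝ) 1))

instance : IsProbabilityMeasure circleMeasure := by
  have : IsProbabilityMeasure (volume.restrict (Set.Ico (0:ℝ) 1)) := ⟨by simp⟩
  exact Measure.isProbabilityMeasure_map (by fun_prop)

theorem ae_circleMeasure_norm_eq_one : ∀ᵐ ζ ∂circleMeasure, ‖ζ‖ = 1 := by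
  refine (ae_map_iff (by fun_prop) (measurableSet_eq_fun (by fun_prop) (by fun_prop))).2 ?_
  refine Eventually.of_forall fun x => ?_
  simp [Complex.norm_exp]

theorem Continuous.exists_bound_circleMeasure {g : ℂ → ℂ} (hg : Continuous g) :
    ∃ C, ∀ᵐ ζ ∂circleMeasure, ‖g ζ‖ ≤ C := by
  obtain ⟨C, hC⟩ := (isCompact_sphere (0 : ℂ) 1).exists_bound_of_continuousOn hg.continuousOn
  refine ⟨C, ?_⟩
  filter_upwards [ae_circleMeasure_norm_eq_one] with ζ h
  exact hC ζ (by simpa using h)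

theorem Continuous.memLp_circleMeasure {g : ℂ → ℂ} (hg : Continuous g) (r : ENNReal) :
    MemLp g r circleMeasure := by
  obtain ⟨C, hC⟩ := hg.exists_bound_circleMeasure
  exact MemLp.of_bound hg.aestronglyMeasurable C hC

theorem Continuous.integrable_circleMeasure {g : ℂ → ℂ} (hg : Continuous g) :
    Integrable g circleMeasure :=
  memLp_one_iff_integrable.1 (hg.memLp_circleMeasure 1)

theorem integral_circleMeasure_pow_mul_conj_pow (a b : ℕ) :
    ∫ ζ, ζ ^ a * conj ζ ^ b ∂circleMeasure = if a = b then 1 else 0 := by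
  rw [circleMeasure, integral_map (by fun_prop)
    (Continuous.aestronglyMeasurable (by fun_prop)), integral_Ico_eq_integral_Ioc,
    ← intervalIntegral.integral_of_le zero_le_one]
  have h (x : ℝ) : Complex.exp (2 * Real.pi * Complex.I * x) ^ a *
      conj (Complex.exp (2 * Real.pi * Complex.I * x)) ^ b =
      Complex.exp (2 * Real.pi * Complex.I * ((a : ℂ) - b) * x) := by
    rw [← Complex.exp_conj, ← Complex.exp_nat_mul, ← Complex.exp_nat_mul, ← Complex.exp_add]
    congr 1
    simp [map_ofNat (starRingEnd ℂ) 2]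
    ring
  simp_rw [h]
  split_ifs with hab
  · simp [hab]
  · have hne : 2 * Real.pi * Complex.I * ((a : ℂ) - b) ≠ 0 :=
      mul_ne_zero Complex.two_pi_I_ne_zero (sub_ne_zero.2 (by exact_mod_cast hab))
    rw [integral_exp_mul_complex hne]
    have h1 : Complex.exp (2 * Real.pi * Complex.I * ((a : ℂ) - b)) = 1 :=
      Complex.exp_eq_one_iff.2 ⟨(a : ℤ) - b, by push_cast; ring⟩
    simp [h1]

/-- `N` times the Fejér kernel of order `N`, as a function on the plane. -/
def fejerSum (N : ℕ) (ζ : ℂ) : ℂ :=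
  (∑ i ∈ Finset.range N, ζ ^ i) * ∑ j ∈ Finset.range N, conj ζ ^ j

theorem fejerSum_eq_norm_sq (N : ℕ) (ζ : ℂ) :
    fejerSum N ζ = ((‖∑ i ∈ Finset.range N, ζ ^ i‖ ^ 2 : ℝ) : ℂ) := by
  have : ∑ j ∈ Finset.range N, conj ζ ^ j = conj (∑ i ∈ Finset.range N, ζ ^ i) := by simp
  rw [fejerSum, this, Complex.mul_conj']
  simp

theorem ofReal_norm_fejerSum (N : ℕ) (ζ : ℂ) : ((‖fejerSum N ζ‖ : ℝ) : ℂ) = fejerSum N ζ := by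
  rw [fejerSum_eq_norm_sq, Complex.norm_real, Real.norm_of_nonneg (by positivity)]

theorem conj_fejerSum (N : ℕ) (ζ : ℂ) : conj (fejerSum N ζ) = fejerSum N ζ := by
  rw [fejerSum_eq_norm_sq, Complex.conj_ofReal]

@[fun_prop]
theorem continuous_fejerSum (N : ℕ) : Continuous (fejerSum N) := by
  unfold fejerSum
  fun_prop

theorem norm_fejerSum_le (N : ℕ) {ζ : ℂ} (hζ : ‖ζ‖ = 1) : ‖fejerSum N ζ‖ ≤ (N : ℝ) ^ 2 := by
  rw [fejerSum_eq_norm_sq, Complex.norm_real, Real.norm_of_nonneg (by positivity)]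
  gcongr
  exact (norm_sum_le _ _).trans (by simp [hζ])

theorem integral_pow_mul_fejerSum (N m : ℕ) :
    ∫ ζ, ζ ^ m * fejerSum N ζ ∂circleMeasure = ((N - m : ℕ) : ℂ) := by
  have h (ζ : ℂ) : ζ ^ m * fejerSum N ζ =
      ∑ i ∈ Finset.range N, ∑ j ∈ Finset.range N, ζ ^ (m + i) * conj ζ ^ j := by
    simp_rw [fejerSum, Finset.sum_mul_sum, Finset.mul_sum, pow_add, mul_assoc]
  simp_rw [h]
  rw [integral_finsetSum _ fun i _ => Continuous.integrable_circleMeasure (by fun_prop)]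
  have hi (i : ℕ) : ∫ ζ, ∑ j ∈ Finset.range N, ζ ^ (m + i) * conj ζ ^ j ∂circleMeasure =
      if i ∈ Finset.range (N - m) then 1 else 0 := by
    rw [integral_finsetSum _ fun i _ => Continuous.integrable_circleMeasure (by fun_prop)]
    simp only [integral_circleMeasure_pow_mul_conj_pow, Finset.sum_ite_eq, Finset.mem_range]
    congr 1
    grind
  simp_rw [hi]
  rw [Finset.sum_ite_mem, Finset.inter_eq_right.2 (Finset.range_mono (Nat.sub_le N m))]
  simp

theorem integral_conj_pow_mul_fejerSum (N m : ℕ) :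
    ∫ ζ, conj ζ ^ m * fejerSum N ζ ∂circleMeasure = ((N - m : ℕ) : ℂ) := by
  have h (ζ : ℂ) : conj ζ ^ m * fejerSum N ζ = conj (ζ ^ m * fejerSum N ζ) := by
    rw [map_mul, conj_fejerSum, map_pow]
  simp_rw [h]
  rw [integral_conj, integral_pow_mul_fejerSum, Complex.conj_natCast]

theorem integral_norm_fejerSum (N : ℕ) : ∫ ζ, ‖fejerSum N ζ‖ ∂circleMeasure = N := by
  apply Complex.ofReal_injective
  rw [← integral_complex_ofReal]
  simpa [ofReal_norm_fejerSum] using integral_pow_mul_fejerSum N 0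

/-- Dirichlet's test for the series `∑ γⁿ / n`. -/
theorem exists_bound_sum_pow_div {γ : ℂ} (h1 : ‖γ‖ = 1) (h : γ ≠ 1) :
    ∃ B : ℝ, ∀ N : ℕ, ‖∑ n ∈ Finset.range N, (1 : ℂ) / (n + 1) * γ ^ (n + 1)‖ ≤ B := by
  have hanti : Antitone fun n : ℕ => (1 : ℝ) / (n + 1) := fun m n hmn =>
    one_div_le_one_div_of_le (by positivity) (by gcongr)
  have hb (n : ℕ) : ‖∑ i ∈ Finset.range n, γ ^ (i + 1)‖ ≤ 2 / ‖γ - 1‖ := by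
    simp_rw [pow_succ]
    rw [← Finset.sum_mul, geom_sum_eq h, norm_mul, norm_div, h1, mul_one]
    gcongr
    exact (norm_sub_le _ _).trans (by simp [h1]; norm_num)
  obtain ⟨B, hB⟩ := (hanti.cauchySeq_series_mul_of_tendsto_zero_of_bounded
    tendsto_one_div_add_atTop_nhds_zero_nat hb).isBounded_range.exists_norm_le
  refine ⟨B, fun N => ?_⟩
  simpa [Complex.real_smul] using hB _ ⟨N, rfl⟩

theorem exists_bound_sum_pow_div_fin {p : ℕ} {γ : Fin p → ℂ} (h : ∀ i, ‖γ i‖ = 1 ∧ γ i ≠ 1) :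
    ∃ B : ℝ, ∀ N : ℕ,
      ‖∑ n ∈ Finset.range N, (1 : ℂ) / (n + 1) * ∑ i, γ i ^ (n + 1)‖ ≤ B := by
  choose B hB using fun i => exists_bound_sum_pow_div (h i).1 (h i).2
  refine ⟨∑ i, B i, fun N => ?_⟩
  simp_rw [Finset.mul_sum]
  rw [Finset.sum_comm]
  exact norm_sum_le_of_le _ fun i _ => hB i N

/-- The pairing of the symbol's partial sums, shifted by `a`, with the Fejér sum. -/
theorem integral_add_const_mul_fejerSum (u v a : ℂ) {p q : ℕ} (α : Fin p → ℂ) (β : Fin q → ℂ)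
    {N M : ℕ} (hNM : N ≤ M) :
    ∫ ζ, (∑ n ∈ Finset.range M, ((1 : ℂ) / (n + 1)) *
          (u * ζ ^ (n + 1) + (∑ i, (α i) ^ (n + 1) * ζ ^ (n + 1)) +
            v * (conj ζ) ^ (n + 1) + ∑ j, (β j) ^ (n + 1) * (conj ζ) ^ (n + 1)) + a) *
        fejerSum N ζ ∂circleMeasure =
      ∑ n ∈ Finset.range N, (1 : ℂ) / (n + 1) *
        (u + (∑ i, α i ^ (n + 1)) + v + ∑ j, β j ^ (n + 1)) * (N - (n + 1)) + a * N := by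
  have h (ζ : ℂ) : (∑ n ∈ Finset.range M, ((1 : ℂ) / (n + 1)) *
          (u * ζ ^ (n + 1) + (∑ i, (α i) ^ (n + 1) * ζ ^ (n + 1)) +
            v * (conj ζ) ^ (n + 1) + ∑ j, (β j) ^ (n + 1) * (conj ζ) ^ (n + 1)) + a) *
        fejerSum N ζ =
      (∑ n ∈ Finset.range M,
        ((1 : ℂ) / (n + 1) * (u + ∑ i, α i ^ (n + 1)) * (ζ ^ (n + 1) * fejerSum N ζ) +
        (1 : ℂ) / (n + 1) * (v + ∑ j, β j ^ (n + 1)) * (conj ζ ^ (n + 1) * fejerSum N ζ))) +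
      a * (ζ ^ 0 * fejerSum N ζ) := by
    simp_rw [← Finset.sum_mul]
    rw [add_mul, Finset.sum_mul, pow_zero, one_mul]
    congr 1
    exact Finset.sum_congr rfl fun n _ => by ring
  simp_rw [h]
  rw [integral_add (Continuous.integrable_circleMeasure (by fun_prop))
      (Continuous.integrable_circleMeasure (by fun_prop)),
    integral_finsetSum _ fun i _ => Continuous.integrable_circleMeasure (by fun_prop)]
  have hn (n : ℕ) : ∫ ζ,
        ((1 : ℂ) / (n + 1) * (u + ∑ i, α i ^ (n + 1)) * (ζ ^ (n + 1) * fejerSum N ζ) +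
        (1 : ℂ) / (n + 1) * (v + ∑ j, β j ^ (n + 1)) * (conj ζ ^ (n + 1) * fejerSum N ζ))
        ∂circleMeasure = (1 : ℂ) / (n + 1) *
        (u + (∑ i, α i ^ (n + 1)) + v + ∑ j, β j ^ (n + 1)) * ((N - (n + 1) : ℕ) : ℂ) := by
    rw [integral_add (Continuous.integrable_circleMeasure (by fun_prop))
      (Continuous.integrable_circleMeasure (by fun_prop)), integral_const_mul,
      integral_const_mul, integral_pow_mul_fejerSum, integral_conj_pow_mul_fejerSum]
    ring
  simp_rw [hn]
  rw [integral_const_mul, integral_pow_mul_fejerSum, Nat.sub_zero,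
    ← Finset.sum_subset (Finset.range_mono hNM)]
  · congr 1
    refine Finset.sum_congr rfl fun n hn => ?_
    rw [Nat.cast_sub (by grind)]
    push_cast
    rfl
  · intro n _ hn
    rw [Nat.sub_eq_zero_of_le (by grind)]
    simp

/-- If `φ + a` is bounded by `c` and `S` is close to `φ` in `L²`, the pairing of `S + a` with the
Fejér sum is controlled. -/
theorem norm_integral_mul_fejerSum_le {φ S : ℂ → ℂ} (hφ : MemLp φ 2 circleMeasure)
    (hS : Continuous S) {a : ℂ} {c : ℝ} (hc : ∀ᵐ ζ ∂circleMeasure, ‖φ ζ + a‖ ≤ c) {N : ℕ}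
    (hN : (N : ℝ) ^ 4 * ∫ ζ, ‖φ ζ - S ζ‖ ^ 2 ∂circleMeasure ≤ 1) :
    ‖∫ ζ, (S ζ + a) * fejerSum N ζ ∂circleMeasure‖ ≤ c * N + 2 := by
  have hF : Integrable (fun ζ => c * ‖fejerSum N ζ‖) circleMeasure :=
    ((continuous_fejerSum N).integrable_circleMeasure.norm).const_mul c
  have hD : Integrable (fun ζ => (N : ℝ) ^ 4 * ‖φ ζ - S ζ‖ ^ 2) circleMeasure :=
    ((hφ.sub (hS.memLp_circleMeasure 2)).integrable_norm_pow two_ne_zero).const_mul _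
  have hFD : Integrable
      (fun ζ => c * ‖fejerSum N ζ‖ + (N : ℝ) ^ 4 * ‖φ ζ - S ζ‖ ^ 2) circleMeasure := hF.add hD
  have key : ‖∫ ζ, (S ζ + a) * fejerSum N ζ ∂circleMeasure‖ ≤
      ∫ ζ, (c * ‖fejerSum N ζ‖ + (N : ℝ) ^ 4 * ‖φ ζ - S ζ‖ ^ 2) + 1 ∂circleMeasure := by
    refine norm_integral_le_of_norm_le (hFD.add (integrable_const 1)) ?_
    filter_upwards [hc, ae_circleMeasure_norm_eq_one] with ζ hζ h1
    have hle := norm_fejerSum_le N h1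
    have hsplit : (S ζ + a) * fejerSum N ζ =
        (φ ζ + a) * fejerSum N ζ - (φ ζ - S ζ) * fejerSum N ζ := by ring
    have h2 : ‖(φ ζ + a) * fejerSum N ζ‖ ≤ c * ‖fejerSum N ζ‖ := by
      rw [norm_mul]
      gcongr
    have h3 : ‖(φ ζ - S ζ) * fejerSum N ζ‖ ≤ ‖φ ζ - S ζ‖ * (N : ℝ) ^ 2 := by
      rw [norm_mul]
      gcongr
    rw [hsplit]
    nlinarith [norm_sub_le ((φ ζ + a) * fejerSum N ζ) ((φ ζ - S ζ) * fejerSum N ζ),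
      sq_nonneg (‖φ ζ - S ζ‖ * (N : ℝ) ^ 2 - 1), sq_nonneg (‖φ ζ - S ζ‖ * (N : ℝ) ^ 2)]
  rw [integral_add hFD (integrable_const 1), integral_add hF hD, integral_const_mul,
    integral_const_mul, integral_norm_fejerSum] at key
  simp only [integral_const, probReal_univ, smul_eq_mul, mul_one] at key
  linarith

/-- The Fejér means at `1` of the symbol's Fourier series are unbounded. -/
theorem not_exists_bound_fejer_means {k : ℕ} (hk : 1 ≤ k) (l : ℕ) {p q : ℕ}
    {α : Fin p → ℂ} {β : Fin q → ℂ}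
    (hα : ∀ i, ‖α i‖ = 1 ∧ α i ≠ 1) (hβ : ∀ j, ‖β j‖ = 1 ∧ β j ≠ 1) (a : ℂ) :
    ¬ ∃ C : ℝ, ∀ N : ℕ, ‖∑ n ∈ Finset.range N, (1 : ℂ) / (n + 1) *
        ((k : ℂ) + (∑ i, α i ^ (n + 1)) + (l : ℂ) + ∑ j, β j ^ (n + 1)) * (N - (n + 1)) +
          a * N‖ ≤ C * N + 2 := by
  rintro ⟨C, hC⟩
  obtain ⟨A, hA⟩ := exists_bound_sum_pow_div_fin hα
  obtain ⟨B, hB⟩ := exists_bound_sum_pow_div_fin hβ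
  obtain ⟨N, hN, hN1⟩ := ((Real.tendsto_sum_range_one_div_nat_succ_atTop.eventually_gt_atTop
    (A + B + (k + p + l + q) + ‖a‖ + C + 2)).and (eventually_ge_atTop 1)).exists
  have hN0 : (1 : ℝ) ≤ N := by exact_mod_cast hN1
  set c : ℕ → ℂ := fun n => (k : ℂ) + (∑ i, α i ^ (n + 1)) + (l : ℂ) + ∑ j, β j ^ (n + 1) with hc
  have hcn (n : ℕ) : ‖c n‖ ≤ k + p + l + q := by
    have hα' : ‖∑ i, α i ^ (n + 1)‖ ≤ p :=
      (norm_sum_le _ _).trans (by simp [fun i => (hα i).1])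
    have hβ' : ‖∑ j, β j ^ (n + 1)‖ ≤ q :=
      (norm_sum_le _ _).trans (by simp [fun j => (hβ j).1])
    refine (norm_add_le _ _).trans (add_le_add ((norm_add_le _ _).trans
      (add_le_add ((norm_add_le _ _).trans (add_le_add ?_ hα')) ?_)) hβ') <;> simp
  have hcs : ‖∑ n ∈ Finset.range N, c n‖ ≤ N * (k + p + l + q) :=
    (norm_sum_le_of_le _ fun n _ => hcn n).trans_eq
      (by rw [Finset.sum_const, Finset.card_range, nsmul_eq_mul])
  have hsplit : ((k + l : ℕ) : ℂ) * ((∑ n ∈ Finset.range N, (1 / (n + 1) : ℝ) : ℝ) : ℂ) * N =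
      (∑ n ∈ Finset.range N, (1 : ℂ) / (n + 1) * c n * (N - (n + 1)) + a * N)
      - a * N + (∑ n ∈ Finset.range N, c n)
      - (∑ n ∈ Finset.range N, (1 : ℂ) / (n + 1) * ∑ i, α i ^ (n + 1)) * N
      - (∑ n ∈ Finset.range N, (1 : ℂ) / (n + 1) * ∑ j, β j ^ (n + 1)) * N := by
    rw [add_sub_cancel_right]
    push_cast
    rw [Finset.mul_sum, Finset.sum_mul, Finset.sum_mul, Finset.sum_mul, ← Finset.sum_add_distrib,
      ← Finset.sum_sub_distrib, ← Finset.sum_sub_distrib]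
    refine Finset.sum_congr rfl fun n _ => ?_
    have : (n : ℂ) + 1 ≠ 0 := Nat.cast_add_one_ne_zero n
    simp only [hc]
    field_simp
    ring
  set H : ℝ := ∑ n ∈ Finset.range N, (1 / (n + 1) : ℝ)
  have hH : 0 ≤ H := Finset.sum_nonneg fun n _ => by positivity
  have hlow : H * N ≤ ‖((k + l : ℕ) : ℂ) * (H : ℂ) * N‖ := by
    rw [norm_mul, norm_mul, Complex.norm_natCast, Complex.norm_natCast, Complex.norm_real,
      Real.norm_of_nonneg hH]
    gcongr
    exact le_mul_of_one_le_left hH (by exact_mod_cast hk.trans (Nat.le_add_right k l))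
  have hup : ‖((k + l : ℕ) : ℂ) * (H : ℂ) * N‖ ≤
      (C * N + 2) + ‖a‖ * N + N * (k + p + l + q) + A * N + B * N := by
    rw [hsplit]
    refine (norm_sub_le _ _).trans (add_le_add ((norm_sub_le _ _).trans (add_le_add
      ((norm_add_le _ _).trans (add_le_add ((norm_sub_le _ _).trans
        (add_le_add (hC N) ?_)) hcs)) ?_)) ?_)
    · simp
    · rw [norm_mul, Complex.norm_natCast]
      gcongr
      exact hA N
    · rw [norm_mul, Complex.norm_natCast]
      gcongr
      exact hB N
  nlinarith

/-- A logarithmically divergent lacunary-type symbol is essentially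
unbounded.  Let `k ≥ 1`, `l ≥ 0`, and let `α₁,…,α_p`, `β₁,…,β_q` be unimodular numbers all
different from `1`.  If `φ ∈ L²(𝕋)` is the sum of the `L²`-convergent series
`k Σ n⁻¹ζⁿ + Σ_i Σ n⁻¹αᵢⁿζⁿ + l Σ n⁻¹conj(ζ)ⁿ + Σ_j Σ n⁻¹βⱼⁿ conj(ζ)ⁿ`, then `φ` is not
essentially bounded, and neither is `φ + a` for any constant `a ∈ ℂ`. -/
theorem log_symbol_not_essentially_bounded
    (k : ℕ) (hk : 1 ≤ k) (l : ℕ) (p q : ℕ)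
    (α : Fin p → ℂ) (β : Fin q → ℂ)
    (hα : ∀ i, ‖α i‖ = 1 ∧ α i ≠ 1) (hβ : ∀ j, ‖β j‖ = 1 ∧ β j ≠ 1)
    (φ : Lp ℂ 2 circleMeasure)
    (hφ : Tendsto (fun N => ∫ ζ, ‖⇑φ ζ - ∑ n ∈ Finset.range N,
        ((1 : ℂ) / (n + 1)) *
          ((k : ℂ) * ζ ^ (n + 1) + (∑ i : Fin p, (α i) ^ (n + 1) * ζ ^ (n + 1)) +
            (l : ℂ) * (conj ζ) ^ (n + 1) +
            ∑ j : Fin q, (β j) ^ (n + 1) * (conj ζ) ^ (n + 1))‖ ^ 2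
      ∂circleMeasure) atTop (𝓝 0)) :
    (¬ ∃ c : ℝ, ∀ᵐ ζ ∂circleMeasure, ‖⇑φ ζ‖ ≤ c) ∧
    (∀ a : ℂ, ¬ ∃ c : ℝ, ∀ᵐ ζ ∂circleMeasure, ‖⇑φ ζ + a‖ ≤ c) := by
  have main (a : ℂ) : ¬ ∃ c : ℝ, ∀ᵐ ζ ∂circleMeasure, ‖φ ζ + a‖ ≤ c := by
    rintro ⟨c, hc⟩
    refine not_exists_bound_fejer_means hk l hα hβ a ⟨c, fun N => ?_⟩
    have hlim := hφ.const_mul ((N : ℝ) ^ 4)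
    rw [mul_zero] at hlim
    obtain ⟨M, hM, hNM⟩ :=
      ((hlim.eventually_le_const zero_lt_one).and (eventually_ge_atTop N)).exists
    rw [← integral_add_const_mul_fejerSum k l a α β hNM]
    exact norm_integral_mul_fejerSum_le (Lp.memLp φ) (by fun_prop) hc hM
  exact ⟨by simpa using main 0, main⟩

end
end

section
/- For every n ≥ 1 and all complex scalars a₀,…,a_{n−1}: (1/2)·Σ_{i=0}^{n−1} |aᵢ| ≤ ‖ Σ_{i=0}^{n−1} aᵢ (Cᵢ ⊗ Cᵢ) ‖ ≤ Σ_{i=0}^{n−1} |aᵢ|, where Cᵢ ⊗ Cᵢ ∈ M_{4ⁿ}(ℂ) is the Kronecker product and the norm is the operator norm with respect to the Euclidean norm on ℂ^{4ⁿ}. -/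
noncomputable section

open Matrix Kronecker

/-- `V = [[1,0],[0,−1]]`. -/
def Vm : Matrix (Fin 2) (Fin 2) ℂ := !![1, 0; 0, -1]

/-- `C = [[0,0],[1,0]]`. -/
def Cm : Matrix (Fin 2) (Fin 2) ℂ := !![0, 0; 1, 0]

/-- The matrix `Cᵢ = V^{⊗i} ⊗ C ⊗ I₂^{⊗(n−i−1)} ∈ M_{2ⁿ}(ℂ)`, written entrywise on the
index set `Fin n → Fin 2 ≃ Fin 2ⁿ`. -/
def CiMat (n i : ℕ) : Matrix (Fin n → Fin 2) (Fin n → Fin 2) ℂ :=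
  fun x y => ∏ k : Fin n,
    if (k : ℕ) < i then Vm (x k) (y k)
    else if (k : ℕ) = i then Cm (x k) (y k)
    else if x k = y k then 1 else 0

/-- A matrix whose entries are dominated by those of a permutation matrix is a contraction. -/
theorem norm_toEuclideanCLM_le_one_of_perm {ι : Type*} [Fintype ι] [DecidableEq ι]
    (M : Matrix ι ι ℂ) (e : Equiv.Perm ι)
    (hM : ∀ x y, ‖M x y‖ ≤ if y = e x then 1 else 0) :
    ‖Matrix.toEuclideanCLM (𝕜 := ℂ) M‖ ≤ 1 := by
  refine ContinuousLinearMap.opNorm_le_bound _ zero_le_one fun v => ?_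
  rw [one_mul, EuclideanSpace.norm_eq, EuclideanSpace.norm_eq,
    ← Equiv.sum_comp e fun i => ‖v i‖ ^ 2]
  refine Real.sqrt_le_sqrt (Finset.sum_le_sum fun x _ => ?_)
  gcongr
  rw [Matrix.ofLp_toEuclideanCLM, Matrix.mulVec, dotProduct]
  calc ‖∑ y, M x y * v y‖ ≤ ∑ y, ‖M x y * v y‖ := norm_sum_le _ _
    _ ≤ ∑ y, if y = e x then ‖v y‖ else 0 := by
        refine Finset.sum_le_sum fun y _ => ?_
        rw [norm_mul]
        refine (mul_le_mul_of_nonneg_right (hM x y) (norm_nonneg _)).trans_eq ?_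
        split_ifs <;> simp
    _ = ‖v (e x)‖ := by simp

theorem norm_CiMat_apply_le (n : ℕ) (i : Fin n) (x y : Fin n → Fin 2) :
    ‖CiMat n i x y‖ ≤ if y = Equiv.addRight (Pi.single i 1) x then 1 else 0 := by
  have h : (if y = Equiv.addRight (Pi.single i 1) x then (1 : ℝ) else 0)
      = ∏ k, if y k = x k + (Pi.single i 1 : Fin n → Fin 2) k then (1 : ℝ) else 0 := by
    rw [Finset.prod_boole]
    simp [funext_iff]
  rw [h, CiMat, norm_prod]
  refine Finset.prod_le_prod (fun _ _ => norm_nonneg _) fun k _ => ?_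
  rcases lt_trichotomy k i with hk | rfl | hk
  · rw [if_pos (by exact_mod_cast hk), Pi.single_eq_of_ne hk.ne]
    generalize x k = s
    generalize y k = t
    fin_cases s <;> fin_cases t <;> simp [Vm]
  · rw [if_neg (lt_irrefl _), if_pos rfl, Pi.single_eq_same]
    generalize x k = s
    generalize y k = t
    fin_cases s <;> fin_cases t <;> simp [Cm]
  · rw [if_neg (by simpa using hk.le), if_neg (by simpa [Fin.ext_iff] using hk.ne'),
      Pi.single_eq_of_ne hk.ne']
    generalize x k = s
    generalize y k = t
    fin_cases s <;> fin_cases t <;> simp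

theorem norm_toEuclideanCLM_CiMat_kronecker_le_one (n : ℕ) (i : Fin n) :
    ‖Matrix.toEuclideanCLM (𝕜 := ℂ) (CiMat n i ⊗ₖ CiMat n i)‖ ≤ 1 := by
  refine norm_toEuclideanCLM_le_one_of_perm _
    ((Equiv.addRight (Pi.single i 1)).prodCongr (Equiv.addRight (Pi.single i 1))) ?_
  rintro ⟨x, x'⟩ ⟨y, y'⟩
  rw [Matrix.kronecker_apply, norm_mul]
  refine (mul_le_mul (norm_CiMat_apply_le n i x y) (norm_CiMat_apply_le n i x' y')
    (norm_nonneg _) (by split_ifs <;> norm_num)).trans_eq ?_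
  simp only [Equiv.prodCongr_apply, Prod.map_apply, Prod.mk.injEq]
  split_ifs <;> simp_all

/-- The vector `∑ₓ (∏ₖ φₖ(xₖ)) eₓ ⊗ eₓ`, where `φₖ(0) = 1` and `φₖ(1) = uₖ`. -/
def diagVec {n : ℕ} (u : Fin n → ℂ) : EuclideanSpace ℂ ((Fin n → Fin 2) × (Fin n → Fin 2)) :=
  WithLp.toLp 2 fun p => if p.1 = p.2 then ∏ k, ![1, u k] (p.1 k) else 0

theorem sum_prod_apply {n : ℕ} {R : Type*} [CommSemiring R] (g : Fin n → Fin 2 → R) :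
    ∑ x : Fin n → Fin 2, ∏ k, g k (x k) = ∏ k, ∑ s, g k s := by
  rw [Finset.prod_univ_sum, Fintype.piFinset_univ]

theorem norm_diagVec_sq {n : ℕ} (u : Fin n → ℂ) (hu : ∀ k, ‖u k‖ = 1) :
    ‖diagVec u‖ ^ 2 = 2 ^ n := by
  rw [EuclideanSpace.norm_sq_eq, Fintype.sum_prod_type]
  have h (x : Fin n → Fin 2) :
      ∑ y, ‖diagVec u (x, y)‖ ^ 2 = ∏ k, ‖(![1, u k] : Fin 2 → ℂ) (x k)‖ ^ 2 := by
    rw [Finset.sum_eq_single x]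
    · simp [diagVec, Finset.prod_pow]
    · intro y _ hy
      simp [diagVec, hy.symm]
    · simp
  simp_rw [h]
  rw [sum_prod_apply fun k s => ‖(![1, u k] : Fin 2 → ℂ) s‖ ^ 2]
  simp [Fin.sum_univ_two, hu]
  norm_num

theorem inner_diagVec_toEuclideanCLM {n : ℕ} (u : Fin n → ℂ)
    (A B : Matrix (Fin n → Fin 2) (Fin n → Fin 2) ℂ) :
    inner ℂ (diagVec u) (Matrix.toEuclideanCLM (𝕜 := ℂ) (A ⊗ₖ B) (diagVec u))
      = ∑ x, ∑ y, star (∏ k, ![1, u k] (x k)) * (A x y * B x y * ∏ k, ![1, u k] (y k)) := by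
  rw [PiLp.inner_apply, Fintype.sum_prod_type]
  refine Finset.sum_congr rfl fun x _ => ?_
  rw [Finset.sum_eq_single x]
  · rw [Matrix.ofLp_toEuclideanCLM, Matrix.mulVec, dotProduct, Fintype.sum_prod_type,
      RCLike.inner_apply', Finset.mul_sum]
    refine Finset.sum_congr rfl fun y _ => ?_
    rw [Finset.sum_eq_single y]
    · simp [diagVec]
    · intro z _ hz
      simp [diagVec, hz.symm]
    · simp
  · intro y _ hy
    simp [diagVec, hy.symm]
  · simp

theorem two_mul_inner_diagVec_CiMat {n : ℕ} (u : Fin n → ℂ) (hu : ∀ k, ‖u k‖ = 1)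
    (i : Fin n) :
    2 * inner ℂ (diagVec u)
        (Matrix.toEuclideanCLM (𝕜 := ℂ) (CiMat n i ⊗ₖ CiMat n i) (diagVec u))
      = 2 ^ n * star (u i) := by
  have hu' (k : Fin n) : star (u k) * u k = 1 := by
    simpa [hu] using RCLike.conj_mul (u k)
  rw [inner_diagVec_toEuclideanCLM]
  set m : Fin n → Fin 2 → Fin 2 → ℂ := fun k s t =>
    if (k : ℕ) < i then Vm s t else if (k : ℕ) = i then Cm s t else if s = t then 1 else 0
    with hm
  have h (x y : Fin n → Fin 2) :
      star (∏ k, (![1, u k] : Fin 2 → ℂ) (x k))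
          * (CiMat n i x y * CiMat n i x y * ∏ k, (![1, u k] : Fin 2 → ℂ) (y k))
        = ∏ k, star ((![1, u k] : Fin 2 → ℂ) (x k))
          * (m k (x k) (y k) * m k (x k) (y k) * (![1, u k] : Fin 2 → ℂ) (y k)) := by
    simp only [CiMat, hm, Finset.prod_mul_distrib, star_prod]
  simp_rw [h]
  have h₂ (x : Fin n → Fin 2) := sum_prod_apply fun k t =>
    star ((![1, u k] : Fin 2 → ℂ) (x k))
          * (m k (x k) t * m k (x k) t * (![1, u k] : Fin 2 → ℂ) t)
  simp_rw [h₂]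
  rw [sum_prod_apply fun k s => ∑ t, star ((![1, u k] : Fin 2 → ℂ) s)
          * (m k s t * m k s t * (![1, u k] : Fin 2 → ℂ) t)]
  have h₃ (k : Fin n) : ∑ s, ∑ t, star ((![1, u k] : Fin 2 → ℂ) s)
      * (m k s t * m k s t * (![1, u k] : Fin 2 → ℂ) t) = if k = i then star (u i) else 2 := by
    rcases lt_trichotomy k i with hk | rfl | hk
    · have := hu' k
      simp only [RCLike.star_def] at this
      simp [hm, hk, hk.ne, Fin.sum_univ_two, Vm, this]
      norm_num
    · simp [hm, Fin.sum_univ_two, Cm]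
    · have hk' : (k : ℕ) ≠ i := fun h => hk.ne' (Fin.ext h)
      have := hu' k
      simp only [RCLike.star_def] at this
      simp [hm, hk.not_gt, hk', hk.ne', Fin.sum_univ_two, this]
      norm_num
  simp_rw [h₃]
  rw [← Finset.mul_prod_erase _ _ (Finset.mem_univ i), if_pos rfl,
    Finset.prod_congr rfl fun k hk => if_neg (Finset.ne_of_mem_erase hk), Finset.prod_const,
    Finset.card_erase_of_mem (Finset.mem_univ i), Finset.card_univ, Fintype.card_fin,
    mul_left_comm, ← pow_succ', Nat.sub_add_cancel (Nat.one_le_iff_ne_zero.2 i.pos.ne'), mul_comm]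

theorem exists_norm_eq_one_mul_star_eq_norm (z : ℂ) :
    ∃ u : ℂ, ‖u‖ = 1 ∧ z * star u = ‖z‖ := by
  have hu : ‖Complex.exp (z.arg * Complex.I)‖ = 1 := Complex.norm_exp_ofReal_mul_I _
  refine ⟨_, hu, ?_⟩
  nth_rewrite 1 [← Complex.norm_mul_exp_arg_mul_I z]
  rw [mul_assoc, RCLike.star_def, Complex.mul_conj']
  simp [hu]

/-- Norm estimate for `Σ aᵢ Cᵢ ⊗ Cᵢ`.  For all complex scalars
`a₀,…,a_{n−1}`, `(1/2)Σ|aᵢ| ≤ ‖Σ aᵢ (Cᵢ ⊗ Cᵢ)‖ ≤ Σ|aᵢ|`, the norm being the operator norm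
with respect to the Euclidean norm. -/
theorem Ci_tensor_norm_estimate (n : ℕ) (hn : 1 ≤ n) (a : Fin n → ℂ) :
    (1 / 2) * (∑ i : Fin n, ‖a i‖)
        ≤ ‖Matrix.toEuclideanCLM (𝕜 := ℂ)
            (∑ i : Fin n, a i • (CiMat n i ⊗ₖ CiMat n i))‖ ∧
    ‖Matrix.toEuclideanCLM (𝕜 := ℂ)
        (∑ i : Fin n, a i • (CiMat n i ⊗ₖ CiMat n i))‖ ≤ ∑ i : Fin n, ‖a i‖ := by
  rw [map_sum]
  simp_rw [map_smul]
  constructor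
  · choose u hu hau using fun k => exists_norm_eq_one_mul_star_eq_norm (a k)
    set T := ∑ i : Fin n, a i • Matrix.toEuclideanCLM (𝕜 := ℂ) (CiMat n i ⊗ₖ CiMat n i) with hT
    have h : 2 * inner ℂ (diagVec u) (T (diagVec u)) = ((2 ^ n * ∑ i, ‖a i‖ : ℝ) : ℂ) := by
      rw [hT, _root_.sum_apply, inner_sum, Finset.mul_sum, Finset.mul_sum]
      push_cast
      refine Finset.sum_congr rfl fun i _ => ?_
      rw [Pi.smul_apply, inner_smul_right, mul_left_comm,
        two_mul_inner_diagVec_CiMat u hu, mul_left_comm, hau]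
    have h' : 2 ^ n * ∑ i, ‖a i‖ ≤ 2 * (‖T‖ * 2 ^ n) := by
      calc 2 ^ n * ∑ i, ‖a i‖ = ‖2 * inner ℂ (diagVec u) (T (diagVec u))‖ := by
            rw [h, Complex.norm_real, Real.norm_of_nonneg (by positivity)]
        _ = 2 * ‖inner ℂ (diagVec u) (T (diagVec u))‖ := by simp
        _ ≤ 2 * (‖diagVec u‖ * (‖T‖ * ‖diagVec u‖)) := by
            gcongr
            exact (norm_inner_le_norm _ _).trans (by gcongr; exact T.le_opNorm _)
        _ = 2 * (‖T‖ * 2 ^ n) := by rw [← norm_diagVec_sq u hu]; ring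
    have h₂ : (0 : ℝ) < 2 ^ n := by positivity
    have : ∑ i, ‖a i‖ ≤ 2 * ‖T‖ := le_of_mul_le_mul_left (by linarith) h₂
    linarith
  · refine (norm_sum_le _ _).trans (Finset.sum_le_sum fun i _ => ?_)
    rw [norm_smul]
    exact mul_le_of_le_one_right (norm_nonneg _) (norm_toEuclideanCLM_CiMat_kronecker_le_one n i)



end
end

section
/- For every n ≥ 1 and all complex scalars α₀,…,α_{n−1}: ‖ Σ_{i=0}^{n−1} αᵢ Cᵢ ‖ = ( Σ_{i=0}^{n−1} |αᵢ|² )^{1/2}, where the norm is the operator norm on M_{2ⁿ}(ℂ) with respect to the Euclidean norm on ℂ^{2ⁿ}; equivalently, the linear map (α₀,…,α_{n−1}) ↦ Σ αᵢCᵢ is an isometry from ℂⁿ with the ℓ²-norm into M_{2ⁿ}(ℂ) with the operator norm. -/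
noncomputable section

open Matrix Kronecker

/-- In a C*-algebra, an element `a` with `a² = 0` and `a a* + a* a = s` satisfies `‖a‖² = s`. -/
theorem norm_sq_eq_of_mul_self_eq_zero {A : Type*} [NormedRing A] [StarRing A] [CStarRing A]
    [NormedAlgebra ℂ A] [Nontrivial A] {a : A} {s : ℝ} (hs : 0 ≤ s) (h0 : a * a = 0)
    (h1 : a * star a + star a * a = (s : ℂ) • (1 : A)) : ‖a‖ ^ 2 = s := by
  by_cases ha : a = 0
  · subst ha
    have h : (s : ℂ) • (1 : A) = 0 := by simpa using h1.symm
    have : s = 0 := by simpa using h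
    simp [this]
  · have hb : (star a * a) * (star a * a) = (s : ℂ) • (star a * a) := by
      calc (star a * a) * (star a * a)
          = star a * (a * star a + star a * a) * a - star a * star a * (a * a) := by noncomm_ring
        _ = (s : ℂ) • (star a * a) := by rw [h1, h0]; simp
    have hn := congrArg norm hb
    rw [(IsSelfAdjoint.star_mul_self a).norm_mul_self, norm_smul, CStarRing.norm_star_mul_self,
      Complex.norm_real, Real.norm_of_nonneg hs] at hn
    have hp : 0 < ‖a‖ := norm_pos_iff.mpr ha
    have := mul_right_cancel₀ (mul_pos hp hp).ne' ((sq _).symm.trans hn)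
    rw [sq, this]

theorem CiMat_zero (n : ℕ) :
    CiMat (n + 1) 0 = (Cm ⊗ₖ (1 : Matrix (Fin n → Fin 2) (Fin n → Fin 2) ℂ)).submatrix
      (Fin.consEquiv fun _ => Fin 2).symm (Fin.consEquiv fun _ => Fin 2).symm := by
  ext x y
  simp [CiMat, Fin.prod_univ_succ, Fin.consEquiv, Matrix.one_apply, Fin.tail, funext_iff,
    Finset.prod_ite_zero]

theorem CiMat_succ (n i : ℕ) :
    CiMat (n + 1) (i + 1) = (Vm ⊗ₖ CiMat n i).submatrix
      (Fin.consEquiv fun _ => Fin 2).symm (Fin.consEquiv fun _ => Fin 2).symm := by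
  ext x y
  simp [CiMat, Fin.prod_univ_succ, Fin.consEquiv, Fin.tail]
  exact Or.inl rfl

theorem sum_smul_CiMat_succ (n : ℕ) (α : Fin (n + 1) → ℂ) :
    ∑ i : Fin (n + 1), α i • CiMat (n + 1) i =
      (α 0 • (Cm ⊗ₖ (1 : Matrix (Fin n → Fin 2) (Fin n → Fin 2) ℂ)) +
        Vm ⊗ₖ ∑ i : Fin n, α i.succ • CiMat n i).submatrix
      (Fin.consEquiv fun _ => Fin 2).symm (Fin.consEquiv fun _ => Fin 2).symm := by
  rw [Fin.sum_univ_succ]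
  simp only [Fin.val_zero, Fin.val_succ, CiMat_zero, CiMat_succ]
  ext x y
  simp [Matrix.sum_apply, Finset.mul_sum, mul_left_comm]

theorem Vm_mul_Vm : Vm * Vm = 1 := by
  ext i j; fin_cases i <;> fin_cases j <;> simp [Vm]

theorem Vm_conjTranspose : Vmᴴ = Vm := by
  ext i j; fin_cases i <;> fin_cases j <;> simp [Vm]

theorem Cm_mul_Cm : Cm * Cm = 0 := by
  ext i j; fin_cases i <;> fin_cases j <;> simp [Cm]

theorem Vm_mul_Cm : Vm * Cm = -(Cm * Vm) := by
  ext i j; fin_cases i <;> fin_cases j <;> simp [Vm, Cm]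

theorem Vm_mul_Cm_conjTranspose : Vm * Cmᴴ = -(Cmᴴ * Vm) := by
  ext i j; fin_cases i <;> fin_cases j <;> simp [Vm, Cm, Matrix.mul_apply]

theorem Cm_mul_conjTranspose_add : Cm * Cmᴴ + Cmᴴ * Cm = 1 := by
  ext i j
  fin_cases i <;> fin_cases j <;>
    simp [Cm, Matrix.add_apply, Matrix.mul_apply, -Matrix.cons_mul]

theorem neg_kronecker {l m n p : Type*} (A : Matrix l m ℂ) (B : Matrix n p ℂ) :
    (-A) ⊗ₖ B = -(A ⊗ₖ B) := by
  ext; simp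

theorem kronecker_mul_self_eq_zero {m : Type*} [Fintype m] [DecidableEq m]
    {B : Matrix m m ℂ} (a : ℂ) (hB : B * B = 0) :
    (a • (Cm ⊗ₖ (1 : Matrix m m ℂ)) + Vm ⊗ₖ B) * (a • (Cm ⊗ₖ (1 : Matrix m m ℂ)) + Vm ⊗ₖ B)
      = 0 := by
  simp [add_mul, mul_add, ← Matrix.mul_kronecker_mul, Cm_mul_Cm, Vm_mul_Cm, hB, neg_kronecker]

theorem kronecker_anticommutator {m : Type*} [Fintype m] [DecidableEq m]
    {B : Matrix m m ℂ} {s : ℝ} (a : ℂ) (hB : B * Bᴴ + Bᴴ * B = (s : ℂ) • 1) :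
    (a • (Cm ⊗ₖ (1 : Matrix m m ℂ)) + Vm ⊗ₖ B) * (a • (Cm ⊗ₖ (1 : Matrix m m ℂ)) + Vm ⊗ₖ B)ᴴ +
      (a • (Cm ⊗ₖ (1 : Matrix m m ℂ)) + Vm ⊗ₖ B)ᴴ * (a • (Cm ⊗ₖ (1 : Matrix m m ℂ)) + Vm ⊗ₖ B)
      = ((‖a‖ ^ 2 + s : ℝ) : ℂ) • 1 := by
  have hC : (Cm * Cmᴴ) ⊗ₖ (1 : Matrix m m ℂ) + (Cmᴴ * Cm) ⊗ₖ (1 : Matrix m m ℂ) = 1 := by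
    rw [← Matrix.add_kronecker, Cm_mul_conjTranspose_add, Matrix.one_kronecker_one]
  have hV : (1 : Matrix (Fin 2) (Fin 2) ℂ) ⊗ₖ (B * Bᴴ) +
      (1 : Matrix (Fin 2) (Fin 2) ℂ) ⊗ₖ (Bᴴ * B) = (s : ℂ) • 1 := by
    rw [← Matrix.kronecker_add, hB, Matrix.kronecker_smul, Matrix.one_kronecker_one]
  have ha : ((‖a‖ ^ 2 + s : ℝ) : ℂ) = a * star a + s := by
    simp [Complex.mul_conj, Complex.normSq_eq_norm_sq]
  rw [ha, add_smul, ← hV, ← hC]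
  simp only [Matrix.conjTranspose_add, Matrix.conjTranspose_smul, Matrix.conjTranspose_kronecker,
    Matrix.conjTranspose_one, Vm_conjTranspose, add_mul, mul_add, smul_mul_assoc, mul_smul_comm,
    ← Matrix.mul_kronecker_mul, Vm_mul_Vm, Vm_mul_Cm, Vm_mul_Cm_conjTranspose, neg_kronecker,
    one_mul, mul_one]
  module

theorem sum_smul_CiMat_relations (n : ℕ) (α : Fin n → ℂ) :
    (∑ i : Fin n, α i • CiMat n i) * (∑ i : Fin n, α i • CiMat n i) = 0 ∧
    (∑ i : Fin n, α i • CiMat n i) * (∑ i : Fin n, α i • CiMat n i)ᴴ +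
      (∑ i : Fin n, α i • CiMat n i)ᴴ * (∑ i : Fin n, α i • CiMat n i)
      = ((∑ i : Fin n, ‖α i‖ ^ 2 : ℝ) : ℂ) • 1 := by
  induction n with
  | zero => simp
  | succ n ih =>
    obtain ⟨h0, h1⟩ := ih fun i => α i.succ
    have h := congrArg (fun M => Matrix.submatrix M (Fin.consEquiv fun _ => Fin 2).symm
      (Fin.consEquiv fun _ => Fin 2).symm) (kronecker_anticommutator (α 0) h1)
    rw [sum_smul_CiMat_succ, Matrix.conjTranspose_submatrix, Matrix.submatrix_mul_equiv,
      Matrix.submatrix_mul_equiv, Matrix.submatrix_mul_equiv, kronecker_mul_self_eq_zero _ h0,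
      Fin.sum_univ_succ]
    exact ⟨rfl, by simpa [Matrix.submatrix_add, Matrix.submatrix_smul] using h⟩

/-- Exact norm of `Σ αᵢ Cᵢ`.  For all complex scalars `α₀,…,α_{n−1}`,
`‖Σ αᵢ Cᵢ‖ = (Σ|αᵢ|²)^{1/2}`; equivalently `α ↦ Σ αᵢ Cᵢ` is an isometry of `ℓ²(ℂⁿ)` into
`M_{2ⁿ}(ℂ)` with the operator norm. -/
theorem Ci_linear_combination_norm (n : ℕ) (hn : 1 ≤ n) (α : Fin n → ℂ) :
    ‖Matrix.toEuclideanCLM (𝕜 := ℂ) (∑ i : Fin n, α i • CiMat n i)‖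
      = Real.sqrt (∑ i : Fin n, ‖α i‖ ^ 2) := by
  obtain ⟨h0, h1⟩ := sum_smul_CiMat_relations n α
  have hs : 0 ≤ ∑ i : Fin n, ‖α i‖ ^ 2 := by positivity
  rw [← Matrix.star_eq_conjTranspose] at h1
  rw [← norm_sq_eq_of_mul_self_eq_zero (a := Matrix.toEuclideanCLM (𝕜 := ℂ)
    (∑ i : Fin n, α i • CiMat n i)) hs (by rw [← map_mul, h0, map_zero])
    (by rw [← map_star, ← map_mul, ← map_mul, ← map_add, h1, map_smul, map_one]),
    Real.sqrt_sq (norm_nonneg _)]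

end
end

section
/- Let T be a polynomially bounded bounded operator on a complex Hilbert space K such that T^k is not similar to a contraction for any positive integer k. Set T_j = θ_j(T, T, …, T) for j = 1,…,d (so in particular T₁ = d·T^m), and let Ω_θ = θ(𝔻^d) = {θ(z) : z ∈ 𝔻^d} ⊂ ℂ^d. Then: (a) there exists a constant c > 0 such that ‖g(T₁,…,T_d)‖ ≤ c·sup_{q ∈ Ω_θ} |g(q)| for every polynomial g ∈ ℂ[p₁,…,p_d]; (b) there is no bounded invertible operator Y on K such that ‖g(YT₁Y^{-1},…,YT_dY^{-1})‖ ≤ sup_{q ∈ Ω_θ} |g(q)| for every polynomial g ∈ ℂ[p₁,…,p_d] (i.e. the tuple (T₁,…,T_d) is not similar to any commuting tuple having the closure of Ω_θ as a spectral set). -/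
noncomputable section

open MvPolynomial

/-- Rudin's basic polynomials for the pseudo-reflection group `G(m,t,d)`:
`θ_i(z) = E_i(z₁^m,…,z_d^m)` for `1 ≤ i ≤ d−1` and `θ_d(z) = (z₁⋯z_d)^{m/t}`. -/
def rudinTheta (m t d : ℕ) : Fin d → MvPolynomial (Fin d) ℂ := fun i =>
  if (i : ℕ) < d - 1 then
    MvPolynomial.aeval (fun j : Fin d => (X j : MvPolynomial (Fin d) ℂ) ^ m)
      (MvPolynomial.esymm (Fin d) ℂ ((i : ℕ) + 1))
  else (∏ j : Fin d, (X j : MvPolynomial (Fin d) ℂ)) ^ (m / t)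

/-- The one-variable polynomial `z ↦ θ_i(z,…,z)`. -/
def rudinThetaDiag (m t d : ℕ) (i : Fin d) : Polynomial ℂ :=
  MvPolynomial.aeval (fun _ : Fin d => (Polynomial.X : Polynomial ℂ)) (rudinTheta m t d i)

/-- For `g ∈ ℂ[p₁,…,p_d]`, the one-variable polynomial `z ↦ g(θ₁(z,…,z),…,θ_d(z,…,z))`;
evaluating it at an operator `T` gives `g(T₁,…,T_d)` for the commuting tuple
`T_j = θ_j(T,…,T)`. -/
def rudinComp (m t d : ℕ) (g : MvPolynomial (Fin d) ℂ) : Polynomial ℂ :=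
  MvPolynomial.aeval (rudinThetaDiag m t d) g

/-- The quotient domain `Ω_θ = θ(𝔻^d)`. -/
def rudinDomain (m t d : ℕ) : Set (Fin d → ℂ) :=
  (fun z => fun i => MvPolynomial.eval z (rudinTheta m t d i)) '' polydisc d

theorem eval_rudinComp (m t d : ℕ) (g : MvPolynomial (Fin d) ℂ) (z : ℂ) :
    Polynomial.eval z (rudinComp m t d g) =
      MvPolynomial.eval (fun i => MvPolynomial.eval (fun _ => z) (rudinTheta m t d i)) g := by
  have h (σ : Type) (v : σ → Polynomial ℂ) (p : MvPolynomial σ ℂ) :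
      Polynomial.eval z (MvPolynomial.aeval v p) =
        MvPolynomial.eval (fun i => Polynomial.eval z (v i)) p := by
    have := MvPolynomial.comp_aeval_apply (f := v) (Polynomial.aeval z) p
    simpa [MvPolynomial.aeval_eq_eval, Polynomial.coe_aeval_eq_eval] using this
  simp [rudinComp, rudinThetaDiag, h]

theorem bddAbove_norm_eval_rudinDomain (m t d : ℕ) (g : MvPolynomial (Fin d) ℂ) :
    BddAbove ((fun q : Fin d → ℂ => ‖MvPolynomial.eval q g‖) '' rudinDomain m t d) := by
  have hθ : Continuous (fun z : Fin d → ℂ => fun i => MvPolynomial.eval z (rudinTheta m t d i)) :=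
    continuous_pi fun i => MvPolynomial.continuous_eval _
  have hK : IsCompact (Set.univ.pi fun _ : Fin d => Metric.closedBall (0 : ℂ) 1) :=
    isCompact_univ_pi fun _ => isCompact_closedBall _ _
  refine ((hK.image hθ).image (MvPolynomial.continuous_eval g).norm).bddAbove.mono ?_
  refine Set.image_mono (Set.image_mono fun z hz i _ => ?_)
  simpa using (hz i).le

theorem norm_eval_rudinComp_le (m t d : ℕ) (g : MvPolynomial (Fin d) ℂ) {z : ℂ}
    (hz : z ∈ Metric.closedBall (0 : ℂ) 1) :
    ‖Polynomial.eval z (rudinComp m t d g)‖ ≤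
      sSup ((fun q : Fin d → ℂ => ‖MvPolynomial.eval q g‖) '' rudinDomain m t d) := by
  rw [← closure_ball (0 : ℂ) one_ne_zero] at hz
  refine closure_minimal (t := {z | ‖Polynomial.eval z (rudinComp m t d g)‖ ≤
    sSup ((fun q : Fin d → ℂ => ‖MvPolynomial.eval q g‖) '' rudinDomain m t d)})
    (fun w hw => ?_) (isClosed_le (Polynomial.continuous _).norm continuous_const) hz
  refine le_csSup (bddAbove_norm_eval_rudinDomain m t d g) ?_
  refine ⟨_, ⟨fun _ => w, fun _ => by simpa using hw, rfl⟩, ?_⟩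
  simp [eval_rudinComp]

theorem rudinTheta_zero (m t d : ℕ) (hd : 2 ≤ d) :
    rudinTheta m t d ⟨0, by omega⟩ = ∑ j : Fin d, (X j : MvPolynomial (Fin d) ℂ) ^ m := by
  have h : 0 < d - 1 := by omega
  simp [rudinTheta, h, MvPolynomial.esymm_one]

/-- A polynomially bounded commuting tuple on the quotient domain not
similar to a tuple with `closure θ(𝔻^d)` as a spectral set.  Let `T` be polynomially bounded
with no power similar to a contraction, and let `T_j = θ_j(T,…,T)`.  Then (a) the tuple
`(T₁,…,T_d)` satisfies a von Neumann inequality over `Ω_θ = θ(𝔻^d)` up to a constant `c`, but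
(b) no similarity `Y` makes the conjugated tuple satisfy it with constant `1`. -/
theorem quotient_tuple_polynomially_bounded_not_similar
    (m t d : ℕ) (hm : 0 < m) (ht : 0 < t) (htm : t ∣ m) (hd : 2 ≤ d)
    {K : Type} [NormedAddCommGroup K] [InnerProductSpace ℂ K] [CompleteSpace K]
    (T : K →L[ℂ] K)
    (hpb : ∃ c : ℝ, ∀ q : Polynomial ℂ,
      ‖Polynomial.aeval T q‖ ≤ c * sSup ((fun z : ℂ => ‖Polynomial.eval z q‖) '' Metric.closedBall 0 1))
    (hnsim : ∀ k : ℕ, 0 < k → ¬ ∃ Y : K ≃L[ℂ] K,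
      ‖(Y : K →L[ℂ] K).comp ((T ^ k).comp ((Y.symm : K ≃L[ℂ] K) : K →L[ℂ] K))‖ ≤ 1) :
    (∃ c : ℝ, 0 < c ∧ ∀ g : MvPolynomial (Fin d) ℂ,
      ‖Polynomial.aeval T (rudinComp m t d g)‖
        ≤ c * sSup ((fun q : Fin d → ℂ => ‖MvPolynomial.eval q g‖) '' rudinDomain m t d)) ∧
    ¬ ∃ Y : K ≃L[ℂ] K, ∀ g : MvPolynomial (Fin d) ℂ,
      ‖(Y : K →L[ℂ] K).comp ((Polynomial.aeval T (rudinComp m t d g)).comp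
          ((Y.symm : K ≃L[ℂ] K) : K →L[ℂ] K))‖
        ≤ sSup ((fun q : Fin d → ℂ => ‖MvPolynomial.eval q g‖) '' rudinDomain m t d) := by
  refine ⟨?_, ?_⟩
  · obtain ⟨c, hc⟩ := hpb
    refine ⟨|c| + 1, by positivity, fun g => (hc _).trans ?_⟩
    have hle : sSup ((fun z : ℂ => ‖Polynomial.eval z (rudinComp m t d g)‖) ''
        Metric.closedBall 0 1) ≤
        sSup ((fun q : Fin d → ℂ => ‖MvPolynomial.eval q g‖) '' rudinDomain m t d) := by
      refine csSup_le ((Metric.nonempty_closedBall.2 zero_le_one).image _) ?_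
      rintro _ ⟨z, hz, rfl⟩
      exact norm_eval_rudinComp_le m t d g hz
    have hnonneg : 0 ≤ sSup ((fun z : ℂ => ‖Polynomial.eval z (rudinComp m t d g)‖) ''
        Metric.closedBall 0 1) := by
      refine Real.sSup_nonneg ?_
      rintro _ ⟨z, -, rfl⟩
      exact norm_nonneg _
    exact mul_le_mul ((le_abs_self c).trans (by linarith)) hle hnonneg (by positivity)
  · rintro ⟨Y, hY⟩
    have hd0 : (d : ℂ) ≠ 0 := by
      have : d ≠ 0 := by omega
      exact_mod_cast this
    set g : MvPolynomial (Fin d) ℂ := C (d : ℂ)⁻¹ * X ⟨0, by omega⟩ with hg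
    have hcomp : rudinComp m t d g = Polynomial.X ^ m := by
      have hdp : Polynomial.C (d : ℂ)⁻¹ * (d : Polynomial ℂ) = 1 := by
        rw [← Polynomial.C_eq_natCast, ← Polynomial.C_mul, inv_mul_cancel₀ hd0, Polynomial.C_1]
      simp [rudinComp, hg, rudinThetaDiag, rudinTheta_zero m t d hd, ← mul_assoc,
        Polynomial.algebraMap_eq, hdp]
    refine hnsim m hm ⟨Y, ?_⟩
    have h := hY g
    rw [hcomp, map_pow, Polynomial.aeval_X] at h
    refine h.trans (csSup_le ?_ ?_)
    · exact Set.Nonempty.image _ (Set.Nonempty.image _ ⟨0, fun i => by simp⟩)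
    · rintro _ ⟨_, ⟨z, hz, rfl⟩, rfl⟩
      have hsum : ‖∑ j : Fin d, z j ^ m‖ ≤ d := by
        refine (norm_sum_le _ _).trans ?_
        have h1 : ∀ j ∈ Finset.univ, ‖z j ^ m‖ ≤ (1 : ℝ) := fun j _ => by
          rw [norm_pow]
          exact pow_le_one₀ (norm_nonneg _) (hz j).le
        simpa using Finset.sum_le_sum h1
      have hd0' : (0 : ℝ) < d := by
        have : 0 < d := by omega
        exact_mod_cast this
      simp only [hg, map_mul, MvPolynomial.eval_C, MvPolynomial.eval_X,
        rudinTheta_zero m t d hd, map_sum, map_pow, norm_mul, norm_inv, Complex.norm_natCast]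
      rw [inv_mul_le_iff₀ hd0', mul_one]
      exact hsum


end
end
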